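/- arXiv:2601.03739 — 4 statements merged into one kernel-verified Lean document; each statement's English description precedes it below -/
import Mathlib

section
/- Let d ≥ 1, Ω ⊂ ℝ^{1+d} open, f : ℝ → ℝ^d be C², and let u ∈ L^∞(Ω) be a quasi-entropy solution with flux f. For every pair (μ̄0, μ̄1) ∈ P_χ there exists a pair (σ0, σ1) ∈ P_χ with (σ0, σ1) ⪯ (μ̄0, μ̄1) that is a minimal element of P_χ for the relation ⪯, i.e. any (σ0', σ1') ∈ P_χ with (σ0', σ1') ⪯ (σ0, σ1) satisfies σ0' = σ0 and σ1' = σ1. -/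
open MeasureTheory Topology Filter Set
open scoped ENNReal NNReal

noncomputable section

/-- Points `(t,x)` of space-time, `d` space dimensions. -/
abbrev Pt (d : ℕ) := ℝ × (Fin d → ℝ)
/-- Points `(t,x,v)` of kinetic space-time. -/
abbrev Pt3 (d : ℕ) := ℝ × (Fin d → ℝ) × ℝ

/-- A locally finite signed Radon measure, represented by its (unique) Jordan
decomposition: a mutually singular pair of locally finite positive measures. -/
structure LocSigned (X : Type*) [TopologicalSpace X] [MeasurableSpace X] where
  pos : Measure X
  neg : Measure X
  posLF : IsLocallyFiniteMeasure pos
  negLF : IsLocallyFiniteMeasure neg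
  sing : Measure.MutuallySingular pos neg

namespace LocSigned

variable {X : Type*} [TopologicalSpace X] [MeasurableSpace X]

/-- Integral of a function against a signed measure. -/
def integral (μ : LocSigned X) (φ : X → ℝ) : ℝ :=
  (∫ x, φ x ∂μ.pos) - ∫ x, φ x ∂μ.neg

/-- Total variation measure `|μ|`. -/
def tv (μ : LocSigned X) : Measure X := μ.pos + μ.neg

/-- The signed measure `-μ`. -/
def negate (μ : LocSigned X) : LocSigned X :=
  ⟨μ.neg, μ.pos, μ.negLF, μ.posLF, μ.sing.symm⟩

theorem restrict_locFin (ν : Measure X) (h : IsLocallyFiniteMeasure ν) (s : Set X) :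
    IsLocallyFiniteMeasure (ν.restrict s) := by
  constructor
  intro x
  obtain ⟨U, hU, hfin⟩ := h.finiteAtNhds x
  exact ⟨U, hU, lt_of_le_of_lt (Measure.restrict_apply_le s U) hfin⟩

/-- Restriction of a signed measure to a set. -/
def restrict (μ : LocSigned X) (s : Set X) : LocSigned X where
  pos := μ.pos.restrict s
  neg := μ.neg.restrict s
  posLF := restrict_locFin μ.pos μ.posLF s
  negLF := restrict_locFin μ.neg μ.negLF s
  sing := μ.sing.mono Measure.restrict_le_self Measure.restrict_le_self

/-- The diffuse (atom-free) part of a signed measure. -/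
def diffuse (μ : LocSigned X) : LocSigned X :=
  μ.restrict {x | μ.tv {x} = 0}

end LocSigned

/-- Smooth real test functions compactly supported in `Ω`. -/
def IsTestFun {E : Type*} [NormedAddCommGroup E] [NormedSpace ℝ E]
    (Ω : Set E) (φ : E → ℝ) : Prop :=
  ContDiff ℝ (⊤ : ℕ∞) φ ∧ HasCompactSupport φ ∧ tsupport φ ⊆ Ω

variable (d : ℕ)

/-- `(η, q)` is an entropy–entropy flux pair for the flux `f`: `η` is `C²` and
`q' = η'·f'` componentwise. -/
def IsEntropyPair (f : ℝ → Fin d → ℝ) (η : ℝ → ℝ) (q : ℝ → Fin d → ℝ) : Prop :=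
  ContDiff ℝ 2 η ∧ Differentiable ℝ q ∧ ∀ v, deriv q v = deriv η v • deriv f v

/-- `u` is a quasi-entropy solution on `Ω` with flux `f`: every entropy dissipation
distribution is (represented by) a locally finite signed Radon measure. -/
def IsQuasiEntropySol (Ω : Set (Pt d)) (f : ℝ → Fin d → ℝ) (u : Pt d → ℝ) : Prop :=
  ∀ η q, IsEntropyPair d f η q →
    ∃ μ : LocSigned (Pt d),
      ∀ φ : Pt d → ℝ, IsTestFun Ω φ →
        (∫ p in Ω, (η (u p) * fderiv ℝ φ p (1, 0) + fderiv ℝ φ p (0, q (u p))))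
          = - μ.integral φ

/-- The kinetic function `χ(t,x,v) = 1_{v ≤ u(t,x)}`. -/
def chiFun (u : Pt d → ℝ) (p : Pt3 d) : ℝ := if p.2.2 ≤ u (p.1, p.2.1) then 1 else 0

/-- The cylinder `Ω × ℝ` in the kinetic variables. -/
def OmegaExt (Ω : Set (Pt d)) : Set (Pt3 d) := {p | (p.1, p.2.1) ∈ Ω}

/-- `(μ0, μ1) ∈ P_χ` : the kinetic equation `∂_t χ + f'(v)·∇_x χ = ∂_v μ1 + μ0`
holds in `D'(Ω × ℝ)`. -/
def MemPchi (Ω : Set (Pt d)) (f : ℝ → Fin d → ℝ) (u : Pt d → ℝ)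
    (μ0 μ1 : LocSigned (Pt3 d)) : Prop :=
  ∀ φ : Pt3 d → ℝ, IsTestFun (OmegaExt d Ω) φ →
    (∫ p in OmegaExt d Ω, chiFun d u p * fderiv ℝ φ p (1, deriv f p.2.2, 0))
      = μ1.integral (fun p => fderiv ℝ φ p (0, 0, 1)) - μ0.integral φ

/-- The order relation `⪯` between pairs of signed measures:
`(σ0, σ1) ⪯ (μ0, μ1)` iff `σ1⁺ ≤ μ1⁺`, `σ1⁻ ≤ μ1⁻` and `|σ0| ≤ |μ0|`. -/
def PairLE (d : ℕ) (σ0 σ1 μ0 μ1 : LocSigned (Pt3 d)) : Prop :=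
  σ1.pos ≤ μ1.pos ∧ σ1.neg ≤ μ1.neg ∧ σ0.tv ≤ μ0.tv


section DensityMinimization

variable {X ι : Type*} [MeasurableSpace X]

/-- Densities `h` (between `a` and `b`) and `k` (between `-1` and `1`) satisfying the family of
linear constraints `∫ h Aᵢ dS - ∫ k Bᵢ dT = cᵢ`. -/
structure IsAdmissible (S T : Measure X) (a b : X → ℝ) (A B : ι → X → ℝ) (c : ι → ℝ)
    (h k : X → ℝ) : Prop where
  bound_left : ∀ᵐ x ∂S, h x ∈ Icc (a x) (b x)
  bound_right : ∀ᵐ x ∂T, k x ∈ Icc (-1 : ℝ) 1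
  balance : ∀ i, (∫ x, h x * A i x ∂S) - ∫ x, k x * B i x ∂T = c i

theorem integrable_bounded_mul {T : Measure X} {k B : X → ℝ} (hk : AEStronglyMeasurable k T)
    (hk1 : ∀ᵐ x ∂T, |k x| ≤ 1) (hB : Integrable B T) : Integrable (fun x => k x * B x) T :=
  hB.bdd_mul (c := 1) hk hk1

namespace IsAdmissible

variable {S T : Measure X} {a b : X → ℝ} {A B : ι → X → ℝ} {c : ι → ℝ} {h k h' k' : X → ℝ}

theorem congr (H : IsAdmissible S T a b A B c h k) (hh : h =ᵐ[S] h') (hk : k =ᵐ[T] k') :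
    IsAdmissible S T a b A B c h' k' where
  bound_left := by filter_upwards [H.bound_left, hh] with x hx e using e ▸ hx
  bound_right := by filter_upwards [H.bound_right, hk] with x hx e using e ▸ hx
  balance i := by
    rw [← H.balance i]
    congr 1 <;> apply integral_congr_ae
    · filter_upwards [hh] with x e; rw [e]
    · filter_upwards [hk] with x e; rw [e]

theorem abs_left_le (H : IsAdmissible S T a b A B c h k) (ha : ∀ x, -1 ≤ a x)
    (hb : ∀ x, b x ≤ 1) : ∀ᵐ x ∂S, |h x| ≤ 1 := by
  filter_upwards [H.bound_left] with x hx
  exact abs_le.2 ⟨(ha x).trans hx.1, hx.2.trans (hb x)⟩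

theorem abs_right_le (H : IsAdmissible S T a b A B c h k) : ∀ᵐ x ∂T, |k x| ≤ 1 := by
  filter_upwards [H.bound_right] with x hx using abs_le.2 hx

theorem convexComb (H : IsAdmissible S T a b A B c h k) (H' : IsAdmissible S T a b A B c h' k')
    (ha : ∀ x, -1 ≤ a x) (hb : ∀ x, b x ≤ 1)
    (hA : ∀ i, Integrable (A i) S) (hB : ∀ i, Integrable (B i) T)
    (mh : AEStronglyMeasurable h S) (mh' : AEStronglyMeasurable h' S)
    (mk : AEStronglyMeasurable k T) (mk' : AEStronglyMeasurable k' T)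
    {r s : ℝ} (hr : 0 ≤ r) (hs : 0 ≤ s) (hrs : r + s = 1) :
    IsAdmissible S T a b A B c (r • h + s • h') (r • k + s • k') where
  bound_left := by
    filter_upwards [H.bound_left, H'.bound_left] with x hx hx'
    exact convex_Icc _ _ hx hx' hr hs hrs
  bound_right := by
    filter_upwards [H.bound_right, H'.bound_right] with x hx hx'
    exact convex_Icc _ _ hx hx' hr hs hrs
  balance i := by
    have e1 : (∫ x, (r • h + s • h') x * A i x ∂S)
        = r * (∫ x, h x * A i x ∂S) + s * ∫ x, h' x * A i x ∂S := by
      rw [← integral_const_mul, ← integral_const_mul, ← integral_add]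
      · congr 1; ext x; simp; ring
      · exact (integrable_bounded_mul mh (H.abs_left_le ha hb) (hA i)).const_mul r
      · exact (integrable_bounded_mul mh' (H'.abs_left_le ha hb) (hA i)).const_mul s
    have e2 : (∫ x, (r • k + s • k') x * B i x ∂T)
        = r * (∫ x, k x * B i x ∂T) + s * ∫ x, k' x * B i x ∂T := by
      rw [← integral_const_mul, ← integral_const_mul, ← integral_add]
      · congr 1; ext x; simp; ring
      · exact (integrable_bounded_mul mk H.abs_right_le (hB i)).const_mul r
      · exact (integrable_bounded_mul mk' H'.abs_right_le (hB i)).const_mul s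
    rw [e1, e2]
    linear_combination r * H.balance i + s * H'.balance i + c i * hrs

theorem of_tendsto_ae {hn kn : ℕ → X → ℝ} (H : ∀ n, IsAdmissible S T a b A B c (hn n) (kn n))
    (ha : ∀ x, -1 ≤ a x) (hb : ∀ x, b x ≤ 1)
    (hA : ∀ i, Integrable (A i) S) (hB : ∀ i, Integrable (B i) T)
    (mh : ∀ n, AEStronglyMeasurable (hn n) S) (mk : ∀ n, AEStronglyMeasurable (kn n) T)
    (hlim : ∀ᵐ x ∂S, Tendsto (fun n => hn n x) atTop (𝓝 (h x)))
    (klim : ∀ᵐ x ∂T, Tendsto (fun n => kn n x) atTop (𝓝 (k x))) :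
    IsAdmissible S T a b A B c h k where
  bound_left := by
    filter_upwards [hlim, ae_all_iff.2 fun n => (H n).bound_left] with x hx hx'
    exact isClosed_Icc.mem_of_tendsto hx (Eventually.of_forall hx')
  bound_right := by
    filter_upwards [klim, ae_all_iff.2 fun n => (H n).bound_right] with x hx hx'
    exact isClosed_Icc.mem_of_tendsto hx (Eventually.of_forall hx')
  balance i := by
    have key : ∀ {ν : Measure X} {g : ℕ → X → ℝ} {g' D : X → ℝ}, Integrable D ν →
        (∀ n, AEStronglyMeasurable (g n) ν) → (∀ n, ∀ᵐ x ∂ν, |g n x| ≤ 1) →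
        (∀ᵐ x ∂ν, Tendsto (fun n => g n x) atTop (𝓝 (g' x))) →
        Tendsto (fun n => ∫ x, g n x * D x ∂ν) atTop (𝓝 (∫ x, g' x * D x ∂ν)) := by
      intro ν g g' D hD mg hg hlim
      refine tendsto_integral_of_dominated_convergence (fun x => |D x|)
        (fun n => (mg n).mul hD.aestronglyMeasurable) hD.abs (fun n => ?_) ?_
      · filter_upwards [hg n] with x hx
        rw [Real.norm_eq_abs, abs_mul]
        exact mul_le_of_le_one_left (abs_nonneg _) hx
      · filter_upwards [hlim] with x hx using hx.mul_const _
    have l1 := key (hA i) mh (fun n => (H n).abs_left_le ha hb) hlim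
    have l2 := key (hB i) mk (fun n => (H n).abs_right_le) klim
    refine tendsto_nhds_unique (l1.sub l2) ?_
    simp_rw [fun n => (H n).balance i]
    exact tendsto_const_nhds

end IsAdmissible

theorem eq_of_norm_le_of_minimal_norm {F : Type*} [NormedAddCommGroup F] [InnerProductSpace ℝ F]
    {K : Set F} (hK : Convex ℝ K) {v w : F} (hv : v ∈ K) (hw : w ∈ K)
    (hmin : ‖(0 : F) - v‖ = ⨅ z : K, ‖(0 : F) - z‖) (hle : ‖w‖ ≤ ‖v‖) : w = v := by
  have h1 := (norm_eq_iInf_iff_real_inner_le_zero hK hv).1 hmin w hw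
  have h2 : ‖w - v‖ ^ 2 = ‖w‖ ^ 2 - ‖v‖ ^ 2 + 2 * inner ℝ (0 - v) (w - v) := by
    rw [norm_sub_sq_real, zero_sub, inner_neg_left, inner_sub_right, real_inner_self_eq_norm_sq,
      real_inner_comm]
    ring
  have h3 : ‖w‖ ^ 2 ≤ ‖v‖ ^ 2 := by gcongr
  have h4 : ‖w - v‖ ^ 2 = 0 := le_antisymm (by linarith) (sq_nonneg _)
  exact sub_eq_zero.1 (norm_eq_zero.1 (pow_eq_zero_iff two_ne_zero |>.1 h4))

theorem IsAdmissible.exists_minimal {S T : Measure X} [SigmaFinite S] [SigmaFinite T]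
    {a b : X → ℝ} {A B : ι → X → ℝ} {c : ι → ℝ} {h₀ k₀ : X → ℝ}
    (H₀ : IsAdmissible S T a b A B c h₀ k₀) (mh₀ : Measurable h₀) (mk₀ : Measurable k₀)
    (ha : ∀ x, -1 ≤ a x) (hb : ∀ x, b x ≤ 1)
    (hA : ∀ i, Integrable (A i) S) (hB : ∀ i, Integrable (B i) T) :
    ∃ h k : X → ℝ, Measurable h ∧ Measurable k ∧ IsAdmissible S T a b A B c h k ∧
      ∀ h' k' : X → ℝ, Measurable h' → Measurable k' → IsAdmissible S T a b A B c h' k' →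
        (∀ᵐ x ∂S, |h' x| ≤ |h x|) → (∀ᵐ x ∂T, |k' x| ≤ |k x|) → h' =ᵐ[S] h ∧ k' =ᵐ[T] k := by
  let L := WithLp 2 (Lp ℝ 2 S.toFinite × Lp ℝ 2 T.toFinite)
  let K : Set L := {v | IsAdmissible S T a b A B c v.fst v.snd}
  have aeS : ae S.toFinite = ae S := ae_toFinite
  have aeT : ae T.toFinite = ae T := ae_toFinite
  have acS : S ≪ S.toFinite := absolutelyContinuous_toFinite S
  have acT : T ≪ T.toFinite := absolutelyContinuous_toFinite T
  have msS (g : Lp ℝ 2 S.toFinite) : AEStronglyMeasurable g S :=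
    (Lp.stronglyMeasurable g).aestronglyMeasurable
  have msT (g : Lp ℝ 2 T.toFinite) : AEStronglyMeasurable g T :=
    (Lp.stronglyMeasurable g).aestronglyMeasurable
  have lift : ∀ h k : X → ℝ, Measurable h → Measurable k → IsAdmissible S T a b A B c h k →
      ∃ v ∈ K, v.fst =ᵐ[S] h ∧ v.snd =ᵐ[T] k := by
    intro h k mh mk H
    have lh : MemLp h 2 S.toFinite :=
      MemLp.of_bound mh.aestronglyMeasurable 1 (by rw [aeS]; exact H.abs_left_le ha hb)
    have lk : MemLp k 2 T.toFinite :=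
      MemLp.of_bound mk.aestronglyMeasurable 1 (by rw [aeT]; exact H.abs_right_le)
    have eh : lh.toLp h =ᵐ[S] h := acS.ae_eq lh.coeFn_toLp
    have ek : lk.toLp k =ᵐ[T] k := acT.ae_eq lk.coeFn_toLp
    exact ⟨WithLp.toLp 2 (lh.toLp h, lk.toLp k), H.congr eh.symm ek.symm, eh, ek⟩
  have hconv : Convex ℝ K := by
    intro v hv w hw r s hr hs hrs
    refine (IsAdmissible.convexComb hv hw ha hb hA hB (msS _) (msS _) (msT _) (msT _)
      hr hs hrs).congr ?_ ?_
    · refine (acS.ae_eq ?_).symm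
      exact (Lp.coeFn_add _ _).trans ((Lp.coeFn_smul _ _).add (Lp.coeFn_smul _ _))
    · refine (acT.ae_eq ?_).symm
      exact (Lp.coeFn_add _ _).trans ((Lp.coeFn_smul _ _).add (Lp.coeFn_smul _ _))
  have hclosed : IsClosed K := by
    refine IsSeqClosed.isClosed fun v w hv hvw => ?_
    have l1 : Tendsto (fun n => (v n).fst) atTop (𝓝 w.fst) :=
      ((WithLp.continuous_fst 2 _ _).tendsto w).comp hvw
    have l2 : Tendsto (fun n => (v n).snd) atTop (𝓝 w.snd) :=
      ((WithLp.continuous_snd 2 _ _).tendsto w).comp hvw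
    obtain ⟨p, hp, hp'⟩ := (tendstoInMeasure_of_tendsto_Lp l1).exists_seq_tendsto_ae
    obtain ⟨q, hq, hq'⟩ := (tendstoInMeasure_of_tendsto_Lp
      (l2.comp hp.tendsto_atTop)).exists_seq_tendsto_ae
    refine IsAdmissible.of_tendsto_ae (fun n => hv (p (q n))) ha hb hA hB (fun n => msS _)
      (fun n => msT _) ?_ ?_
    · filter_upwards [acS.ae_le hp'] with x hx using hx.comp hq.tendsto_atTop
    · exact acT.ae_le hq'
  obtain ⟨v₀, hv₀, -⟩ := lift h₀ k₀ mh₀ mk₀ H₀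
  obtain ⟨v, hv, hmin⟩ := exists_norm_eq_iInf_of_complete_convex ⟨v₀, hv₀⟩
    hclosed.isComplete hconv 0
  refine ⟨v.fst, v.snd, (Lp.stronglyMeasurable _).measurable, (Lp.stronglyMeasurable _).measurable,
    hv, fun h' k' mh' mk' H' hh hk => ?_⟩
  obtain ⟨w, hw, e1, e2⟩ := lift h' k' mh' mk' H'
  have n1 : ‖w.fst‖ ≤ ‖v.fst‖ := by
    apply Lp.norm_le_norm_of_ae_le
    rw [aeS]
    filter_upwards [hh, e1] with x hx e
    simpa [e] using hx
  have n2 : ‖w.snd‖ ≤ ‖v.snd‖ := by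
    apply Lp.norm_le_norm_of_ae_le
    rw [aeT]
    filter_upwards [hk, e2] with x hx e
    simpa [e] using hx
  have n3 : ‖w‖ ≤ ‖v‖ := by
    rw [WithLp.prod_norm_eq_of_L2, WithLp.prod_norm_eq_of_L2]
    gcongr
  obtain rfl := eq_of_norm_le_of_minimal_norm hconv hv hw hmin n3
  exact ⟨e1.symm, e2.symm⟩

end DensityMinimization

namespace LocSigned

theorem isLocallyFiniteMeasure_tv {X : Type*} [TopologicalSpace X] [MeasurableSpace X]
    (μ : LocSigned X) : IsLocallyFiniteMeasure μ.tv := by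
  constructor
  intro x
  obtain ⟨U, hU, hU'⟩ := μ.posLF.finiteAtNhds x
  obtain ⟨V, hV, hV'⟩ := μ.negLF.finiteAtNhds x
  refine ⟨U ∩ V, inter_mem hU hV, ?_⟩
  rw [tv, Measure.add_apply]
  exact ENNReal.add_lt_top.2 ⟨(measure_mono inter_subset_left).trans_lt hU',
    (measure_mono inter_subset_right).trans_lt hV'⟩

theorem eq_of_pos_of_neg {X : Type*} [TopologicalSpace X] [MeasurableSpace X] {μ ν : LocSigned X}
    (hp : μ.pos = ν.pos) (hn : μ.neg = ν.neg) : μ = ν := by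
  cases μ; cases ν; cases hp; cases hn; rfl

theorem withDensity_ofReal_le {X : Type*} [MeasurableSpace X] {T : Measure X} {k : X → ℝ}
    (hk : ∀ᵐ x ∂T, k x ≤ 1) :
    T.withDensity (fun x => ENNReal.ofReal (k x)) ≤ T := by
  conv_rhs => rw [← withDensity_one (μ := T)]
  refine withDensity_mono ?_
  filter_upwards [hk] with x hx
  simpa using hx

theorem withDensity_ofReal_le_iff {X : Type*} [MeasurableSpace X] {T : Measure X}
    [SigmaFinite T] {k k' : X → ℝ} (mk : Measurable k) :
    T.withDensity (fun x => ENNReal.ofReal (k x)) ≤ T.withDensity (fun x => ENNReal.ofReal (k' x))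
      ↔ ∀ᵐ x ∂T, max (k x) 0 ≤ max (k' x) 0 := by
  have key : (∀ᵐ x ∂T, max (k x) 0 ≤ max (k' x) 0) ↔
      (fun x => ENNReal.ofReal (k x)) ≤ᵐ[T] fun x => ENNReal.ofReal (k' x) := by
    refine eventually_congr (Eventually.of_forall fun x => ?_)
    rw [← ENNReal.ofReal_le_ofReal_iff (le_max_right _ _)]
    simp
  rw [key]
  refine ⟨fun h => ?_, withDensity_mono⟩
  refine ae_le_of_forall_setLIntegral_le_of_sigmaFinite (by fun_prop) fun s hs _ => ?_
  rw [← withDensity_apply _ hs, ← withDensity_apply _ hs]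
  exact h s

section Density

variable {X : Type*} [TopologicalSpace X] [MeasurableSpace X]

/-- The signed measure `k T`, for a density `k` with values in `[-1, 1]`. -/
def ofDensity (T : Measure X) [IsLocallyFiniteMeasure T] (k : X → ℝ) (mk : Measurable k)
    (hk : ∀ᵐ x ∂T, |k x| ≤ 1) : LocSigned X where
  pos := T.withDensity fun x => ENNReal.ofReal (k x)
  neg := T.withDensity fun x => ENNReal.ofReal (-k x)
  posLF := Measure.isLocallyFiniteMeasure_of_le (withDensity_ofReal_le <| by
    filter_upwards [hk] with x hx using (le_abs_self _).trans hx)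
  negLF := Measure.isLocallyFiniteMeasure_of_le (withDensity_ofReal_le <| by
    filter_upwards [hk] with x hx using (neg_le_abs _).trans hx)
  sing := by
    have ms : MeasurableSet {x | k x ≤ 0} := measurableSet_le mk measurable_const
    refine ⟨{x | k x ≤ 0}, ms, ?_, ?_⟩
    · rw [withDensity_apply _ ms, setLIntegral_eq_zero_iff ms (by fun_prop)]
      exact ae_of_all _ fun x hx => ENNReal.ofReal_eq_zero.2 hx
    · rw [withDensity_apply _ ms.compl, setLIntegral_eq_zero_iff ms.compl (by fun_prop)]
      refine ae_of_all _ fun x hx => ENNReal.ofReal_eq_zero.2 ?_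
      have : ¬ k x ≤ 0 := hx
      linarith

variable {T : Measure X} [IsLocallyFiniteMeasure T] {k k' : X → ℝ} {mk : Measurable k}
  {mk' : Measurable k'} {hk : ∀ᵐ x ∂T, |k x| ≤ 1} {hk' : ∀ᵐ x ∂T, |k' x| ≤ 1}

theorem ofDensity_congr (h : k =ᵐ[T] k') : ofDensity T k mk hk = ofDensity T k' mk' hk' := by
  apply eq_of_pos_of_neg <;> apply withDensity_congr_ae <;> filter_upwards [h] with x e <;> rw [e]

theorem tv_ofDensity : (ofDensity T k mk hk).tv = T.withDensity fun x => ENNReal.ofReal |k x| := by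
  rw [tv, ofDensity, ← withDensity_add_left (by fun_prop)]
  congr 1
  ext x
  rcases le_total 0 (k x) with h | h
  · simp [abs_of_nonneg h, ENNReal.ofReal_of_nonpos (neg_nonpos.2 h)]
  · simp [abs_of_nonpos h, ENNReal.ofReal_of_nonpos h]

theorem integral_ofDensity {φ : X → ℝ} (hφ : Integrable φ T) :
    (ofDensity T k mk hk).integral φ = ∫ x, k x * φ x ∂T := by
  have hpos : AEStronglyMeasurable (fun x => max (k x) 0) T := by fun_prop
  have hneg : AEStronglyMeasurable (fun x => max (-k x) 0) T := by fun_prop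
  rw [integral, ofDensity,
    integral_withDensity_eq_integral_toReal_smul (by fun_prop) (by simp),
    integral_withDensity_eq_integral_toReal_smul (by fun_prop) (by simp), ← integral_sub]
  · congr 1
    ext x
    simp only [ENNReal.toReal_ofReal', smul_eq_mul]
    rw [← sub_mul]
    congr 1
    rcases le_total 0 (k x) with h | h <;> simp [h]
  · simp only [ENNReal.toReal_ofReal', smul_eq_mul]
    refine integrable_bounded_mul hpos ?_ hφ
    filter_upwards [hk] with x hx
    rw [abs_of_nonneg (le_max_right _ _)]
    exact max_le ((le_abs_self _).trans hx) zero_le_one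
  · simp only [ENNReal.toReal_ofReal', smul_eq_mul]
    refine integrable_bounded_mul hneg ?_ hφ
    filter_upwards [hk] with x hx
    rw [abs_of_nonneg (le_max_right _ _)]
    exact max_le ((neg_le_abs _).trans hx) zero_le_one

/-- A signed measure whose total variation is dominated by `T` has a density with respect to `T`
with values in `[-1, 1]`. -/
theorem exists_eq_ofDensity [SigmaFinite T] (σ : LocSigned X) (h : σ.tv ≤ T) :
    ∃ (k : X → ℝ) (mk : Measurable k) (_ : ∀ x, |k x| ≤ 1) (hk : ∀ᵐ x ∂T, |k x| ≤ 1),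
      σ = ofDensity T k mk hk := by
  classical
  obtain ⟨s, ms, hp, hn⟩ := σ.sing
  have hsf : SigmaFinite σ.tv := Measure.sigmaFinite_of_le T h
  have hρ : T.withDensity (σ.tv.rnDeriv T) = σ.tv :=
    Measure.withDensity_rnDeriv_eq _ _ (Measure.absolutelyContinuous_of_le h)
  have hρ1 : ∀ᵐ x ∂T, σ.tv.rnDeriv T x ≤ 1 := Measure.rnDeriv_le_one_of_le h
  let r : X → ℝ := fun x => min (σ.tv.rnDeriv T x).toReal 1
  have mr : Measurable r := (Measure.measurable_rnDeriv _ _).ennreal_toReal.min measurable_const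
  have r0 : ∀ x, 0 ≤ r x := fun x => le_min ENNReal.toReal_nonneg zero_le_one
  have r1 : ∀ x, r x ≤ 1 := fun x => min_le_right _ _
  have hr : ∀ᵐ x ∂T, ENNReal.ofReal (r x) = σ.tv.rnDeriv T x := by
    filter_upwards [hρ1] with x hx
    have hx' : (σ.tv.rnDeriv T x).toReal ≤ 1 :=
      ENNReal.toReal_le_of_le_ofReal zero_le_one (by simpa)
    rw [show r x = (σ.tv.rnDeriv T x).toReal from min_eq_left hx',
      ENNReal.ofReal_toReal (hx.trans_lt ENNReal.one_lt_top).ne]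
  have mk : Measurable fun x => if x ∈ s then -r x else r x := mr.neg.ite ms mr
  have hk : ∀ x, |if x ∈ s then -r x else r x| ≤ 1 := by
    intro x
    split_ifs <;> simp [abs_of_nonneg (r0 x), r1 x]
  have restr : ∀ t, MeasurableSet t →
      σ.tv.restrict t = T.withDensity (t.indicator (σ.tv.rnDeriv T)) := by
    intro t mt
    rw [withDensity_indicator mt, ← restrict_withDensity mt, hρ]
  refine ⟨_, mk, hk, ae_of_all _ hk, eq_of_pos_of_neg ?_ ?_⟩
  · have e : σ.pos = σ.tv.restrict sᶜ := by
      rw [tv, Measure.restrict_add, Measure.restrict_eq_zero.2 hn, add_zero,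
        Measure.restrict_eq_self_of_ae_mem]
      exact measure_eq_zero_iff_ae_notMem.1 hp
    rw [e, restr _ ms.compl]
    refine withDensity_congr_ae ?_
    filter_upwards [hr] with x hx
    by_cases hxs : x ∈ s
    · simp [hxs, r0 x]
    · simp [hxs, hx]
  · have e : σ.neg = σ.tv.restrict s := by
      rw [tv, Measure.restrict_add, Measure.restrict_eq_zero.2 hp, zero_add,
        Measure.restrict_eq_self_of_ae_mem]
      simpa using measure_eq_zero_iff_ae_notMem.1 hn
    rw [e, restr _ ms]
    refine withDensity_congr_ae ?_
    filter_upwards [hr] with x hx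
    by_cases hxs : x ∈ s
    · simp [hxs, hx]
    · simp [hxs, r0 x]

end Density

end LocSigned

theorem IsTestFun.integrable {E : Type*} [NormedAddCommGroup E] [NormedSpace ℝ E]
    [MeasurableSpace E] [BorelSpace E] {Ω : Set E} {φ : E → ℝ}
    (h : IsTestFun Ω φ) (T : Measure E) [IsLocallyFiniteMeasure T] : Integrable φ T :=
  h.1.continuous.integrable_of_hasCompactSupport h.2.1

theorem IsTestFun.integrable_fderiv_apply {E : Type*} [NormedAddCommGroup E] [NormedSpace ℝ E]
    [MeasurableSpace E] [BorelSpace E] {Ω : Set E} {φ : E → ℝ}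
    (h : IsTestFun Ω φ) (T : Measure E) [IsLocallyFiniteMeasure T] (e : E) :
    Integrable (fun x => fderiv ℝ φ x e) T :=
  ((h.1.continuous_fderiv (by simp)).clm_apply continuous_const).integrable_of_hasCompactSupport
    (h.2.1.fderiv_apply ℝ e)

/-- The kinetic equation for measures with densities is a balance of weighted integrals. -/
theorem memPchi_ofDensity_iff {d : ℕ} {Ω : Set (Pt d)} {f : ℝ → Fin d → ℝ} {u : Pt d → ℝ}
    {S T : Measure (Pt3 d)} [IsLocallyFiniteMeasure S] [IsLocallyFiniteMeasure T]
    {h k : Pt3 d → ℝ} {mh : Measurable h} {mk : Measurable k}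
    {hh : ∀ᵐ x ∂S, |h x| ≤ 1} {hk : ∀ᵐ x ∂T, |k x| ≤ 1} :
    MemPchi d Ω f u (.ofDensity T k mk hk) (.ofDensity S h mh hh) ↔
      ∀ φ : {φ : Pt3 d → ℝ // IsTestFun (OmegaExt d Ω) φ},
        (∫ p, h p * fderiv ℝ φ.1 p (0, 0, 1) ∂S) - ∫ p, k p * φ.1 p ∂T
          = ∫ p in OmegaExt d Ω, chiFun d u p * fderiv ℝ φ.1 p (1, deriv f p.2.2, 0) := by
  rw [MemPchi, Subtype.forall]
  refine forall₂_congr fun φ hφ => ?_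
  rw [LocSigned.integral_ofDensity (hφ.integrable T),
    LocSigned.integral_ofDensity (hφ.integrable_fderiv_apply S _), eq_comm]

/-- Below any pair `(μ̄0, μ̄1) ∈ P_χ` there is a `⪯`-minimal
element of `P_χ`. -/
theorem statement3 (d : ℕ) (hd : 1 ≤ d) (Ω : Set (Pt d)) (hΩ : IsOpen Ω)
    (f : ℝ → Fin d → ℝ) (hf : ContDiff ℝ 2 f)
    (u : Pt d → ℝ) (hum : Measurable u)
    (hub : ∃ C : ℝ, ∀ᵐ p ∂(volume.restrict Ω), |u p| ≤ C)
    (hqes : IsQuasiEntropySol d Ω f u)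
    (μb0 μb1 : LocSigned (Pt3 d)) (hmem : MemPchi d Ω f u μb0 μb1) :
    ∃ σ0 σ1 : LocSigned (Pt3 d),
      MemPchi d Ω f u σ0 σ1 ∧ PairLE d σ0 σ1 μb0 μb1 ∧
      ∀ σ0' σ1' : LocSigned (Pt3 d),
        MemPchi d Ω f u σ0' σ1' → PairLE d σ0' σ1' σ0 σ1 → σ0' = σ0 ∧ σ1' = σ1 := by
  have lS : IsLocallyFiniteMeasure μb1.tv := μb1.isLocallyFiniteMeasure_tv
  have lT : IsLocallyFiniteMeasure μb0.tv := μb0.isLocallyFiniteMeasure_tv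
  generalize hS : μb1.tv = S at lS
  generalize hT : μb0.tv = T at lT
  obtain ⟨s, ms, s1, s1', rfl⟩ := μb1.exists_eq_ofDensity hS.le
  obtain ⟨g, mg, g1, g1', rfl⟩ := μb0.exists_eq_ofDensity hT.le
  have ha : ∀ x, -1 ≤ -max (-s x) 0 := fun x =>
    neg_le_neg (max_le ((neg_le_abs _).trans (s1 x)) zero_le_one)
  have hb : ∀ x, max (s x) 0 ≤ 1 := fun x => max_le ((le_abs_self _).trans (s1 x)) zero_le_one
  obtain ⟨h, k, mh, mk, H, hmin⟩ := IsAdmissible.exists_minimal (S := S) (T := T)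
    (a := fun x => -max (-s x) 0) (b := fun x => max (s x) 0) (h₀ := s) (k₀ := g)
    ⟨ae_of_all _ fun x => ⟨neg_le.1 (le_max_left _ _), le_max_left _ _⟩,
      ae_of_all _ fun x => abs_le.1 (g1 x), memPchi_ofDensity_iff.1 hmem⟩ ms mg ha hb
    (fun φ => φ.2.integrable_fderiv_apply S _) (fun φ => φ.2.integrable T)
  have le1 : (LocSigned.ofDensity S h mh (H.abs_left_le ha hb)).pos ≤
      (LocSigned.ofDensity S s ms s1').pos := by
    refine (LocSigned.withDensity_ofReal_le_iff mh).2 ?_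
    filter_upwards [H.bound_left] with x hx using max_le hx.2 (le_max_right _ _)
  have le2 : (LocSigned.ofDensity S h mh (H.abs_left_le ha hb)).neg ≤
      (LocSigned.ofDensity S s ms s1').neg := by
    refine (LocSigned.withDensity_ofReal_le_iff mh.neg).2 ?_
    filter_upwards [H.bound_left] with x hx using max_le (neg_le.1 hx.1) (le_max_right _ _)
  have le0 : (LocSigned.ofDensity T k mk H.abs_right_le).tv ≤ T := by
    rw [LocSigned.tv_ofDensity]
    exact LocSigned.withDensity_ofReal_le H.abs_right_le
  refine ⟨.ofDensity T k mk H.abs_right_le, .ofDensity S h mh (H.abs_left_le ha hb),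
    memPchi_ofDensity_iff.2 H.balance, ⟨le1, le2, le0.trans hT.ge⟩, ?_⟩
  rintro σ0 σ1 hσ ⟨lp, ln, l0⟩
  obtain ⟨k', mk', -, k1', rfl⟩ := σ0.exists_eq_ofDensity (l0.trans le0)
  obtain ⟨h', mh', -, h1', rfl⟩ := σ1.exists_eq_ofDensity
    ((add_le_add (lp.trans le1) (ln.trans le2)).trans hS.le)
  have lp' := (LocSigned.withDensity_ofReal_le_iff mh').1 lp
  have ln' := (LocSigned.withDensity_ofReal_le_iff mh'.neg).1 ln
  rw [LocSigned.tv_ofDensity, LocSigned.tv_ofDensity,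
    LocSigned.withDensity_ofReal_le_iff (by fun_prop)] at l0
  have H' := memPchi_ofDensity_iff.1 hσ
  suffices h' =ᵐ[S] h ∧ k' =ᵐ[T] k from
    ⟨LocSigned.ofDensity_congr this.2, LocSigned.ofDensity_congr this.1⟩
  refine hmin h' k' mh' mk' ⟨?_, ?_, H'⟩ ?_ ?_
  · filter_upwards [lp', ln', H.bound_left] with x hp hn hx
    have hn' : max (-h' x) 0 ≤ max (-h x) 0 := hn
    refine ⟨neg_le.1 (((le_max_left _ _).trans hn').trans ?_), ((le_max_left _ _).trans hp).trans ?_⟩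
    · exact max_le (neg_le.1 hx.1) (le_max_right _ _)
    · exact max_le hx.2 (le_max_right _ _)
  · filter_upwards [k1'] with x hx using abs_le.1 hx
  · filter_upwards [lp', ln'] with x hp hn
    have hn' : max (-h' x) 0 ≤ max (-h x) 0 := hn
    refine abs_le'.2 ⟨((le_max_left _ _).trans hp).trans ?_, ((le_max_left _ _).trans hn').trans ?_⟩
    · exact max_le (le_abs_self _) (abs_nonneg _)
    · exact max_le (neg_le_abs _) (abs_nonneg _)
  · filter_upwards [l0] with x hx
    simpa using hx
end
end

section
/- Let f : [0,1] → ℝ be C² and weakly genuinely nonlinear. Then for every v̄ ∈ (0,1) and every δ ∈ (0, v̄] the quantity 𝔥⁻(v̄, δ) satisfies 0 < 𝔥⁻(v̄, δ) < δ, and the supremum defining it is attained (it is a maximum); similarly, for every δ ∈ (0, 1 − v̄], 0 < 𝔥⁺(v̄, δ) < δ and the supremum defining it is attained. -/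
open MeasureTheory Topology Filter Set
open scoped ENNReal NNReal

noncomputable section

/-- A scalar flux is weakly genuinely nonlinear on `(0,1)`. -/
def WGN1 (f : ℝ → ℝ) : Prop :=
  ∀ τ ξ : ℝ, τ ^ 2 + ξ ^ 2 = 1 →
    volume {v ∈ Set.Ioo (0 : ℝ) 1 | τ + ξ * deriv f v = 0} = 0

/-- `𝔥⁻(v̄, δ)`, measuring the nonlinearity of `f` to the left of `v̄`
(`sSup ∅ = 0` by convention in `ℝ`). -/
def hminus (f : ℝ → ℝ) (vb δ : ℝ) : ℝ :=
  sSup {h : ℝ | 0 < h ∧ ENNReal.ofReal h ≤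
    volume (Set.Ioo (vb - δ) vb ∩ {v | 2 * h ≤ |deriv f vb - deriv f v|})}

/-- `𝔥⁺(v̄, δ)`, measuring the nonlinearity of `f` to the right of `v̄`. -/
def hplus (f : ℝ → ℝ) (vb δ : ℝ) : ℝ :=
  sSup {h : ℝ | 0 < h ∧ ENNReal.ofReal h ≤
    volume (Set.Ioo vb (vb + δ) ∩ {v | 2 * h ≤ |deriv f vb - deriv f v|})}

/-- The supremum of `{h > 0 | h ≤ μ (I ∩ {2 h ≤ φ})}` over a bounded open interval `I` is positive,
smaller than the length of `I`, and attained, as soon as the continuous function `φ` is positive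
somewhere in `I` and vanishes at some point of the closure of `I`. -/
theorem sSup_superlevel_Ioo {a b c x : ℝ} {φ : ℝ → ℝ} (hφ : Continuous φ)
    (hc : c ∈ closure (Ioo a b)) (hφc : φ c = 0) (hx : x ∈ Ioo a b) (hφx : 0 < φ x) {s : ℝ}
    (hs : s = sSup {h : ℝ | 0 < h ∧
      ENNReal.ofReal h ≤ volume (Ioo a b ∩ {v | 2 * h ≤ φ v})}) :
    0 < s ∧ s < b - a ∧ ENNReal.ofReal s ≤ volume (Ioo a b ∩ {v | 2 * s ≤ φ v}) := by
  have hab : 0 < b - a := by linarith [hx.1, hx.2]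
  have hfin (t : Set ℝ) : volume (Ioo a b ∩ t) ≠ ∞ :=
    measure_ne_top_of_subset inter_subset_left (by simp)
  have hmeas (h : ℝ) : MeasurableSet {v | 2 * h ≤ φ v} :=
    (isClosed_le continuous_const hφ).measurableSet
  set S := {h : ℝ | 0 < h ∧ ENNReal.ofReal h ≤ volume (Ioo a b ∩ {v | 2 * h ≤ φ v})}
  have hne : S.Nonempty := by
    have hpos : 0 < volume (Ioo a b ∩ {v | φ x / 2 < φ v}) :=
      (isOpen_Ioo.inter (isOpen_lt continuous_const hφ)).measure_pos volume
        ⟨x, hx, half_lt_self hφx⟩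
    refine ⟨min (φ x / 4) (volume (Ioo a b ∩ {v | φ x / 2 < φ v})).toReal,
      lt_min (by linarith) (ENNReal.toReal_pos hpos.ne' (hfin _)), ?_⟩
    calc ENNReal.ofReal (min (φ x / 4) (volume (Ioo a b ∩ {v | φ x / 2 < φ v})).toReal)
        ≤ ENNReal.ofReal (volume (Ioo a b ∩ {v | φ x / 2 < φ v})).toReal :=
          ENNReal.ofReal_le_ofReal (min_le_right _ _)
      _ = volume (Ioo a b ∩ {v | φ x / 2 < φ v}) := ENNReal.ofReal_toReal (hfin _)
      _ ≤ _ := by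
          refine measure_mono (inter_subset_inter_right _ fun v hv => ?_)
          have h₁ := min_le_left (φ x / 4) (volume (Ioo a b ∩ {v | φ x / 2 < φ v})).toReal
          simp only [mem_ofPred_eq] at hv ⊢
          linarith
  have hbdd : BddAbove S := by
    refine ⟨b - a, fun h hh => ?_⟩
    have h₁ := hh.2.trans (measure_mono inter_subset_left)
    rw [Real.volume_Ioo] at h₁
    exact (ENNReal.ofReal_le_ofReal_iff hab.le).1 h₁
  have hs0 : 0 < s := by
    obtain ⟨h, hh⟩ := hne
    exact hh.1.trans_le (hs ▸ le_csSup hbdd hh)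
  have hlow (h : ℝ) (hh : h < s) :
      ENNReal.ofReal h ≤ volume (Ioo a b ∩ {v | 2 * h ≤ φ v}) := by
    obtain ⟨k, hk, hhk⟩ := exists_lt_of_lt_csSup hne (hs ▸ hh)
    refine (ENNReal.ofReal_le_ofReal hhk.le).trans (hk.2.trans (measure_mono ?_))
    refine inter_subset_inter_right _ fun v (hv : 2 * k ≤ φ v) => ?_
    exact (by linarith : 2 * h ≤ φ v)
  have hatt : ENNReal.ofReal s ≤ volume (Ioo a b ∩ {v | 2 * s ≤ φ v}) := by
    obtain ⟨u, hu_mono, hu_lt, hu_tendsto⟩ := exists_seq_strictMono_tendsto s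
    have hinter : Ioo a b ∩ {v | 2 * s ≤ φ v} = ⋂ n, Ioo a b ∩ {v | 2 * u n ≤ φ v} := by
      rw [← inter_iInter]
      congr 1
      ext v
      simp only [mem_ofPred_eq, mem_iInter]
      exact ⟨fun hv n => by linarith [hu_lt n],
        fun hv => le_of_tendsto' (hu_tendsto.const_mul 2) hv⟩
    rw [hinter]
    refine le_of_tendsto_of_tendsto' (ENNReal.tendsto_ofReal hu_tendsto)
      (tendsto_measure_iInter_atTop
        (fun n => (measurableSet_Ioo.inter (hmeas (u n))).nullMeasurableSet) ?_ ⟨0, hfin _⟩)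
      fun n => hlow _ (hu_lt n)
    intro m n hmn
    refine inter_subset_inter_right _ fun v (hv : 2 * u n ≤ φ v) => ?_
    exact (by linarith [hu_mono.monotone hmn] : 2 * u m ≤ φ v)
  refine ⟨hs0, ?_, hatt⟩
  have hopen : IsOpen {v | φ v < 2 * s} := isOpen_lt hφ continuous_const
  have hpos : 0 < volume (Ioo a b \ {v | 2 * s ≤ φ v}) := by
    have hdiff : Ioo a b \ {v | 2 * s ≤ φ v} = {v | φ v < 2 * s} ∩ Ioo a b := by
      ext v
      simp [and_comm]
    rw [hdiff]
    refine (hopen.inter isOpen_Ioo).measure_pos volume (mem_closure_iff.1 hc _ hopen ?_)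
    simp only [mem_ofPred_eq, hφc]
    linarith
  have hlt : volume (Ioo a b ∩ {v | 2 * s ≤ φ v}) < volume (Ioo a b) := by
    rw [← measure_inter_add_sdiff (Ioo a b) (hmeas s)]
    exact ENNReal.lt_add_right (hfin _) hpos.ne'
  have h₁ := hatt.trans_lt hlt
  rw [Real.volume_Ioo] at h₁
  exact (ENNReal.ofReal_lt_ofReal_iff hab).1 h₁

/-- The derivative of a weakly genuinely nonlinear flux is not constant on any subinterval. -/
theorem WGN1.exists_abs_sub_deriv_pos {f : ℝ → ℝ} (hf : WGN1 f) {a b : ℝ} (ha : 0 ≤ a)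
    (hb : b ≤ 1) (hab : a < b) (d : ℝ) : ∃ x ∈ Ioo a b, 0 < |d - deriv f x| := by
  by_contra! hcon
  have hr : 0 < √(1 + d ^ 2) := by positivity
  have hzero := hf (-d / √(1 + d ^ 2)) (1 / √(1 + d ^ 2)) (by
    rw [div_pow, div_pow, Real.sq_sqrt (by positivity)]
    field_simp
    ring)
  have hsub : Ioo a b ⊆ {v ∈ Ioo (0 : ℝ) 1 |
      -d / √(1 + d ^ 2) + 1 / √(1 + d ^ 2) * deriv f v = 0} := by
    intro v hv
    refine ⟨⟨ha.trans_lt hv.1, hv.2.trans_le hb⟩, ?_⟩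
    rw [← sub_eq_zero.1 (abs_nonpos_iff.1 (hcon v hv))]
    ring
  exact (isOpen_Ioo.measure_pos volume (nonempty_Ioo.2 hab)).ne' (measure_mono_null hsub hzero)

/-- For a `C²` weakly genuinely nonlinear flux, `0 < 𝔥^±(v̄,δ) < δ`
and the suprema defining `𝔥^±` are attained. -/
theorem statement9 (f : ℝ → ℝ) (hf : ContDiff ℝ 2 f) (hwgn : WGN1 f) :
    ∀ vb ∈ Set.Ioo (0 : ℝ) 1,
      (∀ δ : ℝ, 0 < δ → δ ≤ vb →
        0 < hminus f vb δ ∧ hminus f vb δ < δ ∧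
        ENNReal.ofReal (hminus f vb δ) ≤
          volume (Set.Ioo (vb - δ) vb ∩
            {v | 2 * hminus f vb δ ≤ |deriv f vb - deriv f v|})) ∧
      (∀ δ : ℝ, 0 < δ → δ ≤ 1 - vb →
        0 < hplus f vb δ ∧ hplus f vb δ < δ ∧
        ENNReal.ofReal (hplus f vb δ) ≤
          volume (Set.Ioo vb (vb + δ) ∩
            {v | 2 * hplus f vb δ ≤ |deriv f vb - deriv f v|})) := by
  intro vb hvb
  have hφ : Continuous fun v => |deriv f vb - deriv f v| :=
    (continuous_const.sub (hf.continuous_deriv (by norm_num))).abs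
  refine ⟨fun δ hδ hδvb => ?_, fun δ hδ hδvb => ?_⟩
  · have hlt : vb - δ < vb := by linarith
    obtain ⟨x, hx, hφx⟩ := hwgn.exists_abs_sub_deriv_pos (sub_nonneg.2 hδvb) hvb.2.le hlt
      (deriv f vb)
    have key := sSup_superlevel_Ioo (s := hminus f vb δ) hφ
      (closure_Ioo hlt.ne ▸ right_mem_Icc.2 hlt.le) (by simp) hx hφx rfl
    rwa [sub_sub_cancel] at key
  · have hlt : vb < vb + δ := by linarith
    obtain ⟨x, hx, hφx⟩ := hwgn.exists_abs_sub_deriv_pos hvb.1.le (by linarith) hlt (deriv f vb)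
    have key := sSup_superlevel_Ioo (s := hplus f vb δ) hφ
      (closure_Ioo hlt.ne ▸ left_mem_Icc.2 hlt.le) (by simp) hx hφx rfl
    rwa [add_sub_cancel_left] at key
end
end

section
/- Let f : [0,1] → ℝ be C², let v̄ ∈ (0,1), δ ∈ (0, v̄], and suppose h := 𝔥⁻(v̄, δ) > 0. Then there exists a nonempty interval J ⊂ (v̄ − δ, v̄) such that |f'(v̄) − f'(v)| > h for every v ∈ J and L¹(J) · sup_{[0,1]}|f''| ≥ h. -/
open MeasureTheory Topology Filter Set
open scoped ENNReal NNReal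

noncomputable section

/-- If `h := 𝔥⁻(v̄, δ) > 0`, then there is a nonempty interval
`J ⊆ (v̄ - δ, v̄)` on which `|f'(v̄) - f'| > h`, of length `≥ h / sup_{[0,1]}|f''|`. -/
theorem statement10 (f : ℝ → ℝ) (hf : ContDiff ℝ 2 f)
    (vb : ℝ) (hvb : vb ∈ Set.Ioo (0 : ℝ) 1)
    (δ : ℝ) (hδ0 : 0 < δ) (hδ : δ ≤ vb)
    (h : ℝ) (hh : h = hminus f vb δ) (hpos : 0 < h) :
    ∃ a b : ℝ, a < b ∧ Set.Ioo a b ⊆ Set.Ioo (vb - δ) vb ∧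
      (∀ v ∈ Set.Ioo a b, h < |deriv f vb - deriv f v|) ∧
      h ≤ (b - a) * (⨆ v : Set.Icc (0 : ℝ) 1, |deriv (deriv f) ↑v|) := by
  have hdf : ContDiff ℝ 1 (deriv f) :=
    ((contDiff_succ_iff_deriv (n := 1)).1 (by simpa [one_add_one_eq_two] using hf)).2.2
  have hddf : Continuous (deriv (deriv f)) := hdf.continuous_deriv le_rfl
  set g : ℝ → ℝ := fun v => |deriv f vb - deriv f v| with hg
  have hgc : Continuous g := (continuous_const.sub hdf.continuous).abs
  set M : ℝ := ⨆ v : Set.Icc (0 : ℝ) 1, |deriv (deriv f) ↑v| with hM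
  have hbdd : BddAbove (Set.range fun v : Set.Icc (0 : ℝ) 1 => |deriv (deriv f) ↑v|) :=
    (isCompact_range (hddf.abs.comp continuous_subtype_val)).bddAbove
  have hlip : ∀ x ∈ Set.Icc (0 : ℝ) 1, ∀ y ∈ Set.Icc (0 : ℝ) 1,
      |deriv f y - deriv f x| ≤ M * |y - x| := fun x hx y hy =>
    (convex_Icc (0 : ℝ) 1).norm_image_sub_le_of_norm_deriv_le
      (fun z _ => (hdf.differentiable one_ne_zero) z)
      (fun z hz => le_ciSup hbdd ⟨z, hz⟩) hx hy
  obtain ⟨w, hw, hmax⟩ := isCompact_Icc.exists_isMaxOn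
    (Set.nonempty_Icc.2 (by linarith : vb - δ ≤ vb)) hgc.continuousOn
  have hgw : 2 * h ≤ g w := by
    have hle : h ≤ g w / 2 := by
      rw [hh] at hpos ⊢
      refine csSup_le ?_ ?_
      · by_contra hempty
        rw [hminus, Set.not_nonempty_iff_eq_empty.1 hempty, Real.sSup_empty] at hpos
        exact lt_irrefl _ hpos
      · rintro k ⟨hk, hvol⟩
        obtain ⟨v, hv, hkv⟩ := nonempty_of_measure_ne_zero
          ((ENNReal.ofReal_pos.2 hk).trans_le hvol).ne'
        have hkv' : 2 * k ≤ g v := hkv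
        have hvw : g v ≤ g w := hmax (Set.Ioo_subset_Icc_self hv)
        linarith
    linarith
  have hgvb : g vb = 0 := by simp [hg]
  obtain ⟨b, ⟨hb, hgb⟩, hmin⟩ :=
    (isCompact_Icc.inter_right (isClosed_le hgc continuous_const) :
      IsCompact (Set.Icc w vb ∩ {v | g v ≤ h})).exists_isLeast
      ⟨vb, Set.right_mem_Icc.2 hw.2, by simpa [hgvb] using hpos.le⟩
  have hgb' : g b ≤ h := hgb
  have hwb : w < b := hb.1.lt_of_ne (by rintro rfl; linarith)
  refine ⟨w, b, hwb, Set.Ioo_subset_Ioo hw.1 hb.2, fun v hv => ?_, ?_⟩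
  · by_contra! hle
    exact absurd (hmin ⟨⟨hv.1.le, hv.2.le.trans hb.2⟩, hle⟩) hv.2.not_ge
  · have hw01 : w ∈ Set.Icc (0 : ℝ) 1 := ⟨by linarith [hw.1], hw.2.trans hvb.2.le⟩
    have hb01 : b ∈ Set.Icc (0 : ℝ) 1 := ⟨hw01.1.trans hwb.le, hb.2.trans hvb.2.le⟩
    have hwb_lip := hlip w hw01 b hb01
    rw [abs_of_pos (sub_pos.2 hwb)] at hwb_lip
    have htri : g w - g b ≤ |deriv f b - deriv f w| := by
      have := abs_sub_abs_le_abs_sub (deriv f vb - deriv f w) (deriv f vb - deriv f b)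
      rwa [sub_sub_sub_cancel_left] at this
    linarith [mul_comm M (b - w)]
end
end

section
/- Fix 0 < c ≤ M and let (ρ, m) ∈ L^∞([0,T] × ℝ; K) be an entropy solution in K of the isentropic Euler system with γ = 3. Then its Riemann invariants w = m/ρ − ρ and z = m/ρ + ρ are quasi-entropy solutions of the Burgers equation ∂_t u + ∂_x(u²/2) = 0 on (0,T) × ℝ. -/
open MeasureTheory Topology Filter Set
open scoped ENNReal NNReal

noncomputable section

/-- The compact state space `K = {(ρ,m) : |(ρ,m)| ≤ M, ρ ≥ c}`. -/
def Kset (c M : ℝ) : Set (ℝ × ℝ) := {p | ‖p‖ ≤ M ∧ c ≤ p.1}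

/-- The time-slab `Ω = (0,T) × ℝ`. -/
def Slab1 (T : ℝ) : Set (ℝ × ℝ) := {p | p.1 ∈ Set.Ioo 0 T}

/-- The slab `(0,T) × ℝ × ℝ` in kinetic variables. -/
def SlabExt1 (T : ℝ) : Set (ℝ × ℝ × ℝ) := {p | p.1 ∈ Set.Ioo 0 T}

/-- The projection `p_{t,x}(t,x,v) = (t,x)`. -/
def projTX1 : ℝ × ℝ × ℝ → ℝ × ℝ := fun p => (p.1, p.2.1)

/-- The flux of the isentropic Euler system with `γ = 3`:
`f(ρ, m) = (m, m²/ρ + ρ³/3)`. -/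
def eulerFlux : ℝ × ℝ → ℝ × ℝ := fun p => (p.2, p.2 ^ 2 / p.1 + p.1 ^ 3 / 3)

/-- `U = (ρ, m)` is an entropy solution in `K` of the isentropic Euler system with
`γ = 3` on `(0,T) × ℝ`: a distributional solution dissipating every convex `C²`
entropy on `K`. -/
def IsEntropySolK (c M T : ℝ) (U : ℝ × ℝ → ℝ × ℝ) : Prop :=
  Measurable U ∧ (∀ p, U p ∈ Kset c M) ∧
  (∀ φ : ℝ × ℝ → ℝ, IsTestFun (Slab1 T) φ →
    (∫ p in Slab1 T,
      ((U p).1 * fderiv ℝ φ p (1, 0) + (U p).2 * fderiv ℝ φ p (0, 1))) = 0 ∧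
    (∫ p in Slab1 T,
      ((U p).2 * fderiv ℝ φ p (1, 0)
        + ((U p).2 ^ 2 / (U p).1 + (U p).1 ^ 3 / 3) * fderiv ℝ φ p (0, 1))) = 0) ∧
  (∀ η Q : ℝ × ℝ → ℝ,
    ContDiffOn ℝ 2 η (Kset c M) → ConvexOn ℝ (Kset c M) η →
    ContDiffOn ℝ 2 Q (Kset c M) →
    (∀ p ∈ Kset c M,
      fderivWithin ℝ Q (Kset c M) p
        = (fderivWithin ℝ η (Kset c M) p).comp (fderiv ℝ eulerFlux p)) →
    ∀ φ : ℝ × ℝ → ℝ, IsTestFun (Slab1 T) φ → (∀ p, 0 ≤ φ p) →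
      0 ≤ ∫ p in Slab1 T,
        (η (U p) * fderiv ℝ φ p (1, 0) + Q (U p) * fderiv ℝ φ p (0, 1)))

/-- The first Riemann invariant `w = m/ρ - ρ`. -/
def wInv (U : ℝ × ℝ → ℝ × ℝ) (p : ℝ × ℝ) : ℝ := (U p).2 / (U p).1 - (U p).1

/-- The second Riemann invariant `z = m/ρ + ρ`. -/
def zInv (U : ℝ × ℝ → ℝ × ℝ) (p : ℝ × ℝ) : ℝ := (U p).2 / (U p).1 + (U p).1

/-- `(η, q)` is an entropy–entropy flux pair for the scalar flux `f`. -/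
def IsEntropyPair1 (f η q : ℝ → ℝ) : Prop :=
  ContDiff ℝ 2 η ∧ Differentiable ℝ q ∧ ∀ v, deriv q v = deriv η v * deriv f v

/-- `u` is a quasi-entropy solution on `Ω ⊆ ℝ²` with scalar flux `f`. -/
def IsQuasiEntropySol1 (Ω : Set (ℝ × ℝ)) (f : ℝ → ℝ) (u : ℝ × ℝ → ℝ) : Prop :=
  ∀ η q, IsEntropyPair1 f η q →
    ∃ μ : LocSigned (ℝ × ℝ),
      ∀ φ : ℝ × ℝ → ℝ, IsTestFun Ω φ →
        (∫ p in Ω, (η (u p) * fderiv ℝ φ p (1, 0) + q (u p) * fderiv ℝ φ p (0, 1)))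
          = - μ.integral φ

open scoped ContDiff CompactlySupported

/-- The pairing of the vector field `(a, b)` with the gradient of `φ`. -/
def gradPairing (a b φ : ℝ × ℝ → ℝ) (p : ℝ × ℝ) : ℝ :=
  a p * fderiv ℝ φ p (1, 0) + b p * fderiv ℝ φ p (0, 1)

lemma continuous_fderiv_apply_const {φ : ℝ × ℝ → ℝ} (hφ : ContDiff ℝ ∞ φ) (v : ℝ × ℝ) :
    Continuous fun p => fderiv ℝ φ p v :=
  (hφ.continuous_fderiv (by simp)).clm_apply continuous_const

lemma hasCompactSupport_fderiv_apply_const {φ : ℝ × ℝ → ℝ} (hc : HasCompactSupport φ) (v : ℝ × ℝ) :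
    HasCompactSupport fun p => fderiv ℝ φ p v :=
  (hc.fderiv (𝕜 := ℝ)).comp_left (g := fun L : (ℝ × ℝ) →L[ℝ] ℝ => L v) (by simp)

lemma integrable_fderiv_apply_const {φ : ℝ × ℝ → ℝ} (hφ : ContDiff ℝ ∞ φ) (hc : HasCompactSupport φ)
    (v : ℝ × ℝ) : Integrable fun p => fderiv ℝ φ p v :=
  (continuous_fderiv_apply_const hφ v).integrable_of_hasCompactSupport
    (hasCompactSupport_fderiv_apply_const hc v)

lemma integrable_gradPairing {a b : ℝ × ℝ → ℝ} (ha : Measurable a) (hb : Measurable b) {B : ℝ}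
    (haB : ∀ p, |a p| ≤ B) (hbB : ∀ p, |b p| ≤ B) {φ : ℝ × ℝ → ℝ} (hφ : ContDiff ℝ ∞ φ)
    (hc : HasCompactSupport φ) : Integrable (gradPairing a b φ) :=
  ((integrable_fderiv_apply_const hφ hc (1, 0)).bdd_mul ha.aestronglyMeasurable
      (Eventually.of_forall haB)).add
    ((integrable_fderiv_apply_const hφ hc (0, 1)).bdd_mul hb.aestronglyMeasurable
      (Eventually.of_forall hbB))

/-- The smooth functions inside the space of compactly supported continuous functions. -/
def smoothCompactlySupported : Submodule ℝ C_c(ℝ × ℝ, ℝ) where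
  carrier := {f | ContDiff ℝ ∞ f}
  add_mem' {f g} hf hg := ContDiff.add (show ContDiff ℝ ∞ f from hf) (show ContDiff ℝ ∞ g from hg)
  zero_mem' := show ContDiff ℝ ∞ fun _ : ℝ × ℝ => (0 : ℝ) from contDiff_const
  smul_mem' r f hf := ContDiff.const_smul r (show ContDiff ℝ ∞ f from hf)

/-- Schwartz's theorem for the divergence of a bounded field on the plane: if the distribution
`φ ↦ ∫ (a, b) · ∇φ` is nonnegative then it is a locally finite measure. -/
lemma exists_measure_of_integral_gradPairing_nonneg {a b : ℝ × ℝ → ℝ} (ha : Measurable a)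
    (hb : Measurable b) {B : ℝ} (haB : ∀ p, |a p| ≤ B) (hbB : ∀ p, |b p| ≤ B)
    (hpos : ∀ φ : ℝ × ℝ → ℝ, ContDiff ℝ ∞ φ → HasCompactSupport φ → (∀ p, 0 ≤ φ p) →
      0 ≤ ∫ p, gradPairing a b φ p) :
    ∃ μ : Measure (ℝ × ℝ), IsLocallyFiniteMeasure μ ∧
      ∀ φ : ℝ × ℝ → ℝ, ContDiff ℝ ∞ φ → HasCompactSupport φ →
        ∫ p, gradPairing a b φ p = ∫ p, φ p ∂μ := by
  have hint : ∀ f : smoothCompactlySupported, Integrable (gradPairing a b f.1) := fun f =>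
    integrable_gradPairing ha hb haB hbB f.2 f.1.hasCompactSupport
  have hdiff : ∀ f : smoothCompactlySupported, Differentiable ℝ f.1 := fun f =>
    ContDiff.differentiable (show ContDiff ℝ ∞ f.1 from f.2) (by simp)
  let D : C_c(ℝ × ℝ, ℝ) →ₗ.[ℝ] ℝ :=
    { domain := smoothCompactlySupported
      toFun :=
        { toFun := fun f => ∫ p, gradPairing a b f.1 p
          map_add' := fun f g => by
            rw [← integral_add (hint f) (hint g)]
            congr 1; ext p
            have : fderiv ℝ (f.1 + g.1 : C_c(ℝ × ℝ, ℝ)) p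
                = fderiv ℝ f.1 p + fderiv ℝ g.1 p := fderiv_add (hdiff f p) (hdiff g p)
            simp only [gradPairing, Submodule.coe_add, this, add_apply]
            ring
          map_smul' := fun r f => by
            rw [RingHom.id_apply, smul_eq_mul, ← integral_const_mul]
            congr 1; ext p
            have : fderiv ℝ (r • f.1 : C_c(ℝ × ℝ, ℝ)) p
                = r • fderiv ℝ f.1 p := fderiv_const_smul (hdiff f p) r
            simp only [gradPairing, Submodule.coe_smul, this, smul_apply,
              smul_eq_mul]
            ring } }
  let S : PointedCone ℝ C_c(ℝ × ℝ, ℝ) :=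
    { carrier := {f | ∀ p, 0 ≤ f p}
      add_mem' := fun hf hg p => add_nonneg (hf p) (hg p)
      zero_mem' := fun _ => le_rfl
      smul_mem' := fun r _ hf p => mul_nonneg r.2 (hf p) }
  obtain ⟨Λ, hΛ, hΛpos⟩ := riesz_extension S D
    (fun f hf => hpos f.1 f.2 f.1.hasCompactSupport hf)
    (fun y => by
      obtain ⟨R, hR⟩ := y.hasCompactSupport.isCompact.isBounded.subset_closedBall (0 : ℝ × ℝ)
      obtain ⟨A, hA⟩ := y.hasCompactSupport.exists_bound_of_continuous y.continuous
      have hA0 : 0 ≤ A := (norm_nonneg _).trans (hA 0)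
      let χ : ContDiffBump (0 : ℝ × ℝ) :=
        ⟨max R 1, max R 1 + 1, by positivity, by linarith⟩
      refine ⟨⟨⟨⟨fun p => A * χ p, continuous_const.mul χ.continuous⟩, χ.hasCompactSupport.mul_left⟩,
        contDiff_const.mul χ.contDiff⟩, ?_⟩
      intro p
      show 0 ≤ A * χ p + y p
      by_cases hp : p ∈ tsupport y
      · rw [χ.one_of_mem_closedBall
          (Metric.closedBall_subset_closedBall (le_max_left _ _) (hR hp))]
        have := neg_le_of_abs_le (hA p)
        linarith
      · rw [image_eq_zero_of_notMem_tsupport hp]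
        have := χ.nonneg (x := p)
        positivity)
  let Λ' : C_c(ℝ × ℝ, ℝ) →ₚ[ℝ] ℝ := PositiveLinearMap.mk₀ Λ hΛpos
  refine ⟨RealRMK.rieszMeasure Λ', inferInstance, fun φ hφ hc => ?_⟩
  have h1 := RealRMK.integral_rieszMeasure Λ' ⟨⟨φ, hφ.continuous⟩, hc⟩
  have h2 := hΛ ⟨⟨⟨φ, hφ.continuous⟩, hc⟩, hφ⟩
  exact h2.symm.trans h1.symm

lemma measurableSet_slab1 (T : ℝ) : MeasurableSet (Slab1 T) :=
  measurableSet_Ioo.preimage measurable_fst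

lemma isOpen_slab1 (T : ℝ) : IsOpen (Slab1 T) :=
  isOpen_Ioo.preimage continuous_fst

lemma fderiv_comp_fst_apply {θ : ℝ → ℝ} (hθ : Differentiable ℝ θ) (p v : ℝ × ℝ) :
    fderiv ℝ (fun q : ℝ × ℝ => θ q.1) p v = v.1 * deriv θ p.1 := by
  have h := (hθ p.1).hasDerivAt.comp_hasFDerivAt p (hasFDerivAt_fst (𝕜 := ℝ) (p := p))
  have h' : HasFDerivAt (fun q : ℝ × ℝ => θ q.1) _ p := h
  rw [h'.fderiv]
  simp [mul_comm]

lemma integral_deriv_fst_mul {θ : ℝ → ℝ} (hθ : ContDiff ℝ ∞ θ) {φ : ℝ × ℝ → ℝ}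
    (hφ : ContDiff ℝ ∞ φ) (hc : HasCompactSupport φ) :
    Integrable (fun p => deriv θ p.1 * φ p) ∧
    Integrable (fun p => θ p.1 * fderiv ℝ φ p (1, 0)) ∧
    ∫ p, deriv θ p.1 * φ p = - ∫ p, θ p.1 * fderiv ℝ φ p (1, 0) := by
  have hd : Differentiable ℝ θ := hθ.differentiable (by simp)
  have e : ∀ p : ℝ × ℝ, fderiv ℝ (fun q : ℝ × ℝ => θ q.1) p (1, 0) = deriv θ p.1 := fun p => by
    rw [fderiv_comp_fst_apply hd]; simp
  have i1 : Integrable (fun p : ℝ × ℝ => deriv θ p.1 * φ p) :=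
    (((hθ.continuous_deriv (by simp)).comp continuous_fst).mul
      hφ.continuous).integrable_of_hasCompactSupport hc.mul_left
  have i2 : Integrable (fun p : ℝ × ℝ => θ p.1 * fderiv ℝ φ p (1, 0)) :=
    ((hθ.continuous.comp continuous_fst).mul
      (continuous_fderiv_apply_const hφ _)).integrable_of_hasCompactSupport
        (hasCompactSupport_fderiv_apply_const hc _).mul_left
  refine ⟨i1, i2, ?_⟩
  have := integral_mul_fderiv_eq_neg_fderiv_mul_of_integrable (𝕜 := ℝ) (μ := volume)
    (f := fun q : ℝ × ℝ => θ q.1) (g := φ) (v := (1, 0)) (by simpa only [e] using i1) i2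
    (((hθ.continuous.comp continuous_fst).mul
      hφ.continuous).integrable_of_hasCompactSupport hc.mul_left)
    (fun p _ => (hd.comp differentiable_fst) p) (fun p _ => hφ.differentiable (by simp) p)
  simp only [e] at this
  rw [this, neg_neg]

lemma tendsto_smoothTransition_natCast_mul_sub_one (t : ℝ) :
    Tendsto (fun n : ℕ => Real.smoothTransition (n * t - 1)) atTop
      (𝓝 ((Ioi (0 : ℝ)).indicator 1 t)) := by
  by_cases ht : 0 < t
  · rw [indicator_of_mem (show t ∈ Ioi (0 : ℝ) from ht)]
    obtain ⟨N, hN⟩ := exists_nat_gt (2 / t)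
    refine tendsto_const_nhds.congr' ?_
    filter_upwards [eventually_ge_atTop N] with n hn
    have h1 : (N : ℝ) ≤ n := by exact_mod_cast hn
    have h2 : 2 < n * t := (div_lt_iff₀ ht).1 (hN.trans_le h1)
    rw [Real.smoothTransition.one_of_one_le (by linarith)]
    rfl
  · rw [indicator_of_notMem (show t ∉ Ioi (0 : ℝ) from ht)]
    refine tendsto_const_nhds.congr fun n => ?_
    rw [Real.smoothTransition.zero_of_nonpos]
    have : (n : ℝ) * t ≤ 0 := mul_nonpos_of_nonneg_of_nonpos n.cast_nonneg (not_lt.1 ht)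
    linarith

/-- A smooth cutoff in time turns a compactly supported function into a test function on the
slab. -/
lemma isTestFun_slab1_cutoff {T ε : ℝ} (hε : 0 < ε) {θ : ℝ → ℝ} (hθ : ContDiff ℝ ∞ θ)
    (h0 : ∀ t, t ∉ Icc ε (T - ε) → θ t = 0) {φ : ℝ × ℝ → ℝ} (hφ : ContDiff ℝ ∞ φ)
    (hc : HasCompactSupport φ) : IsTestFun (Slab1 T) fun p => θ p.1 * φ p := by
  refine ⟨(hθ.comp contDiff_fst).mul hφ, hc.mul_left, ?_⟩
  have hcl : IsClosed {p : ℝ × ℝ | p.1 ∈ Icc ε (T - ε)} := isClosed_Icc.preimage continuous_fst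
  refine (closure_minimal (fun p hp => ?_) hcl).trans fun p hp => ?_
  · by_contra hn
    exact hp (by simp [h0 p.1 hn])
  · have : p.1 ∈ Icc ε (T - ε) := hp
    exact ⟨by linarith [this.1], by linarith [this.2]⟩

/-- The field that equals `a` inside the slab, corrected by constants outside of it so that
cutting off in time only loses mass. -/
def slabExtension (T B : ℝ) (a : ℝ × ℝ → ℝ) (p : ℝ × ℝ) : ℝ :=
  (Slab1 T).indicator a p
    + B * ((Ioi (0 : ℝ)).indicator 1 (T - p.1) - (Ioi (0 : ℝ)).indicator 1 p.1)

lemma integral_gradPairing_slabExtension_nonneg {T : ℝ} {a b : ℝ × ℝ → ℝ} (ha : Measurable a)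
    (hb : Measurable b) {B : ℝ} (haB : ∀ p, |a p| ≤ B) (hbB : ∀ p, |b p| ≤ B)
    (hpos : ∀ φ : ℝ × ℝ → ℝ, IsTestFun (Slab1 T) φ → (∀ p, 0 ≤ φ p) →
      0 ≤ ∫ p in Slab1 T, gradPairing a b φ p)
    {φ : ℝ × ℝ → ℝ} (hφ : ContDiff ℝ ∞ φ) (hc : HasCompactSupport φ) (h0 : ∀ p, 0 ≤ φ p) :
    0 ≤ ∫ p, gradPairing (slabExtension T B a) ((Slab1 T).indicator b) φ p := by
  have hB : 0 ≤ B := (abs_nonneg _).trans (haB 0)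
  set σ := Real.smoothTransition
  let α : ℕ → ℝ → ℝ := fun n t => σ (n * t - 1)
  let β : ℕ → ℝ → ℝ := fun n t => σ (n * (T - t) - 1)
  have hα : ∀ n, ContDiff ℝ ∞ (α n) := fun n =>
    Real.smoothTransition.contDiff.comp (by fun_prop)
  have hβ : ∀ n, ContDiff ℝ ∞ (β n) := fun n =>
    Real.smoothTransition.contDiff.comp (by fun_prop)
  have hαm : ∀ n, Monotone (α n) := fun n s t hst =>
    Real.smoothTransition.monotone (by gcongr)
  have hβm : ∀ n, Antitone (β n) := fun n s t hst =>
    Real.smoothTransition.monotone (by gcongr)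
  have hα0 : ∀ n t, 0 ≤ α n t := fun n t => Real.smoothTransition.nonneg _
  have hα1 : ∀ n t, α n t ≤ 1 := fun n t => Real.smoothTransition.le_one _
  have hβ0 : ∀ n t, 0 ≤ β n t := fun n t => Real.smoothTransition.nonneg _
  have hβ1 : ∀ n t, β n t ≤ 1 := fun n t => Real.smoothTransition.le_one _
  have hα' : ∀ n t, 0 ≤ deriv (α n) t := fun n t => (hαm n).deriv_nonneg
  have hβ' : ∀ n t, deriv (β n) t ≤ 0 := fun n t => (hβm n).deriv_nonpos
  let F : ℕ → ℝ × ℝ → ℝ := fun n p =>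
    (Slab1 T).indicator (fun p => α n p.1 * β n p.1 * gradPairing a b φ p) p
      + B * (β n p.1 * fderiv ℝ φ p (1, 0) - α n p.1 * fderiv ℝ φ p (1, 0))
  have hgi := integrable_gradPairing ha hb haB hbB hφ hc
  have hcut : ∀ n, Integrable
      ((Slab1 T).indicator fun p => α n p.1 * β n p.1 * gradPairing a b φ p) := fun n => by
    refine (hgi.bdd_mul (c := 1) ?_ (Eventually.of_forall fun p => ?_)).indicator
      (measurableSet_slab1 T)
    · exact (((hα n).continuous.comp continuous_fst).mul
        ((hβ n).continuous.comp continuous_fst)).aestronglyMeasurable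
    · rw [Real.norm_of_nonneg (mul_nonneg (hα0 _ _) (hβ0 _ _))]
      exact mul_le_one₀ (hα1 _ _) (hβ0 _ _) (hβ1 _ _)
  have hFnonneg : ∀ n, 1 ≤ n → 0 ≤ ∫ p, F n p := by
    intro n hn
    have hn0 : (0 : ℝ) < n := by exact_mod_cast hn
    obtain ⟨iα, iα', eα⟩ := integral_deriv_fst_mul (hα n) hφ hc
    obtain ⟨iβ, iβ', eβ⟩ := integral_deriv_fst_mul (hβ n) hφ hc
    have htest : IsTestFun (Slab1 T) fun p => (α n p.1 * β n p.1) * φ p := by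
      refine isTestFun_slab1_cutoff (ε := 1 / n) (by positivity) ((hα n).mul (hβ n))
        (fun t ht => ?_) hφ hc
      rw [mem_Icc, not_and_or, not_le, not_le] at ht
      rcases ht with ht | ht
      · have : α n t = 0 := Real.smoothTransition.zero_of_nonpos (by
          rw [lt_div_iff₀ hn0] at ht; linarith)
        simp [this]
      · have : β n t = 0 := Real.smoothTransition.zero_of_nonpos (by
          have : T - t < 1 / n := by linarith
          rw [lt_div_iff₀ hn0] at this; linarith)
        simp [this]
    have key := hpos _ htest fun p => mul_nonneg (mul_nonneg (hα0 _ _) (hβ0 _ _)) (h0 p)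
    rw [← integral_indicator (measurableSet_slab1 T)] at key
    have iG : Integrable fun p : ℝ × ℝ =>
        (Slab1 T).indicator (fun p => α n p.1 * β n p.1 * gradPairing a b φ p) p
          + B * (deriv (α n) p.1 * φ p - deriv (β n) p.1 * φ p) :=
      (hcut n).add ((iα.sub iβ).const_mul B)
    have hle : ∫ p, (Slab1 T).indicator
          (gradPairing a b fun p => (α n p.1 * β n p.1) * φ p) p
        ≤ ∫ p : ℝ × ℝ, ((Slab1 T).indicator (fun p => α n p.1 * β n p.1 * gradPairing a b φ p) p
          + B * (deriv (α n) p.1 * φ p - deriv (β n) p.1 * φ p)) := by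
      refine integral_mono ((integrable_gradPairing ha hb haB hbB htest.1 htest.2.1).indicator
        (measurableSet_slab1 T)) iG fun p => ?_
      have hx : 0 ≤ deriv (α n) p.1 * φ p := mul_nonneg (hα' _ _) (h0 p)
      have hy : 0 ≤ -deriv (β n) p.1 * φ p := mul_nonneg (neg_nonneg.2 (hβ' _ _)) (h0 p)
      by_cases hp : p ∈ Slab1 T
      · simp only [indicator_of_mem hp]
        have hd : Differentiable ℝ fun t => α n t * β n t :=
          ((hα n).mul (hβ n)).differentiable (by simp)
        have hfd : ∀ v, fderiv ℝ (fun p : ℝ × ℝ => (α n p.1 * β n p.1) * φ p) p v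
            = (α n p.1 * β n p.1) * fderiv ℝ φ p v
              + φ p * (v.1 * (deriv (α n) p.1 * β n p.1 + α n p.1 * deriv (β n) p.1)) := by
          intro v
          have h1 : DifferentiableAt ℝ (fun p : ℝ × ℝ => α n p.1 * β n p.1) p :=
            (hd.comp differentiable_fst) p
          have h2 : DifferentiableAt ℝ φ p := hφ.differentiable (by simp) p
          rw [fderiv_fun_mul h1 h2, add_apply, smul_apply,
            smul_apply, fderiv_comp_fst_apply hd,
            deriv_fun_mul ((hα n).differentiable (by simp) _) ((hβ n).differentiable (by simp) _)]
          simp only [smul_eq_mul]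
        simp only [gradPairing, hfd]
        have ha1 := abs_le.1 (haB p)
        have e1 : a p * (deriv (α n) p.1 * φ p) * β n p.1 ≤ B * (deriv (α n) p.1 * φ p) := by
          calc _ ≤ B * (deriv (α n) p.1 * φ p) * β n p.1 := by
                gcongr
                · exact hβ0 _ _
                · exact ha1.2
            _ ≤ _ := mul_le_of_le_one_right (by positivity) (hβ1 _ _)
        have e2 : (-a p) * (-deriv (β n) p.1 * φ p) * α n p.1
            ≤ B * (-deriv (β n) p.1 * φ p) := by
          calc _ ≤ B * (-deriv (β n) p.1 * φ p) * α n p.1 := by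
                gcongr
                · exact hα0 _ _
                · linarith [ha1.1]
            _ ≤ _ := mul_le_of_le_one_right (mul_nonneg hB hy) (hα1 _ _)
        nlinarith [e1, e2]
      · simp only [indicator_of_notMem hp]
        have : 0 ≤ B * (deriv (α n) p.1 * φ p + -deriv (β n) p.1 * φ p) := by positivity
        linarith
    have heq : ∫ p : ℝ × ℝ, ((Slab1 T).indicator
          (fun p => α n p.1 * β n p.1 * gradPairing a b φ p) p
          + B * (deriv (α n) p.1 * φ p - deriv (β n) p.1 * φ p)) = ∫ p, F n p := by
      have iαβ : Integrable fun p : ℝ × ℝ => B * (deriv (α n) p.1 * φ p - deriv (β n) p.1 * φ p) :=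
        (iα.sub iβ).const_mul B
      have iαβ' : Integrable fun p : ℝ × ℝ =>
          B * (β n p.1 * fderiv ℝ φ p (1, 0) - α n p.1 * fderiv ℝ φ p (1, 0)) :=
        (iβ'.sub iα').const_mul B
      rw [integral_add (hcut n) iαβ, integral_const_mul, integral_sub iα iβ,
        integral_add (hcut n) iαβ', integral_const_mul, integral_sub iβ' iα', eα, eβ]
      ring
    exact (key.trans hle).trans_eq heq
  refine ge_of_tendsto (f := fun n => ∫ p, F n p) (x := atTop) ?_
    ((eventually_ge_atTop 1).mono hFnonneg)
  refine tendsto_integral_of_dominated_convergence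
    (fun p => |gradPairing a b φ p| + B * (2 * |fderiv ℝ φ p (1, 0)|)) (fun n => ?_) ?_
    (fun n => Eventually.of_forall fun p => ?_) (Eventually.of_forall fun p => ?_)
  · obtain ⟨-, iα', -⟩ := integral_deriv_fst_mul (hα n) hφ hc
    obtain ⟨-, iβ', -⟩ := integral_deriv_fst_mul (hβ n) hφ hc
    exact ((hcut n).add ((iβ'.sub iα').const_mul B)).1
  · exact hgi.abs.add (((integrable_fderiv_apply_const hφ hc _).abs.const_mul 2).const_mul B)
  · refine (norm_add_le _ _).trans (add_le_add ?_ ?_)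
    · refine (norm_indicator_le_norm_self _ _).trans ?_
      rw [norm_mul, Real.norm_of_nonneg (mul_nonneg (hα0 _ _) (hβ0 _ _))]
      exact mul_le_of_le_one_left (norm_nonneg _) (mul_le_one₀ (hα1 _ _) (hβ0 _ _) (hβ1 _ _))
    · rw [norm_mul, Real.norm_of_nonneg hB, ← sub_mul, norm_mul]
      gcongr
      · rw [Real.norm_eq_abs, abs_le]
        constructor <;> linarith [hα0 n p.1, hα1 n p.1, hβ0 n p.1, hβ1 n p.1]
      · exact le_rfl
  · have tα := tendsto_smoothTransition_natCast_mul_sub_one p.1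
    have tβ := tendsto_smoothTransition_natCast_mul_sub_one (T - p.1)
    have hlim : gradPairing (slabExtension T B a) ((Slab1 T).indicator b) φ p
        = (Slab1 T).indicator (fun p => (Ioi (0 : ℝ)).indicator 1 p.1
            * (Ioi (0 : ℝ)).indicator 1 (T - p.1) * gradPairing a b φ p) p
          + B * ((Ioi (0 : ℝ)).indicator 1 (T - p.1) * fderiv ℝ φ p (1, 0)
            - (Ioi (0 : ℝ)).indicator 1 p.1 * fderiv ℝ φ p (1, 0)) := by
      by_cases hp : p ∈ Slab1 T
      · have h1 : p.1 ∈ Ioi (0 : ℝ) := hp.1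
        have h2 : T - p.1 ∈ Ioi (0 : ℝ) := sub_pos.2 hp.2
        simp only [gradPairing, slabExtension, indicator_of_mem hp, indicator_of_mem h1,
          indicator_of_mem h2, Pi.one_apply]
        ring
      · simp only [gradPairing, slabExtension, indicator_of_notMem hp]
        ring
    rw [hlim]
    refine Tendsto.add ?_ (((tβ.mul_const _).sub (tα.mul_const _)).const_mul B)
    by_cases hp : p ∈ Slab1 T
    · simp only [indicator_of_mem hp]
      exact (tα.mul tβ).mul_const _
    · simp only [indicator_of_notMem hp]
      exact tendsto_const_nhds

/-- A bounded field on the slab whose divergence has a sign has a divergence that is a measure,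
locally finite up to the boundary of the slab. -/
lemma exists_measure_of_integral_gradPairing_slab1_nonneg {T : ℝ} {a b : ℝ × ℝ → ℝ}
    (ha : Measurable a) (hb : Measurable b) {B : ℝ} (haB : ∀ p, |a p| ≤ B) (hbB : ∀ p, |b p| ≤ B)
    (hpos : ∀ φ : ℝ × ℝ → ℝ, IsTestFun (Slab1 T) φ → (∀ p, 0 ≤ φ p) →
      0 ≤ ∫ p in Slab1 T, gradPairing a b φ p) :
    ∃ μ : Measure (ℝ × ℝ), IsLocallyFiniteMeasure μ ∧
      ∀ φ : ℝ × ℝ → ℝ, IsTestFun (Slab1 T) φ →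
        ∫ p in Slab1 T, gradPairing a b φ p = ∫ p, φ p ∂μ := by
  have hB : 0 ≤ B := (abs_nonneg _).trans (haB 0)
  have hmeas : Measurable (slabExtension T B a) := by
    have hi : Measurable ((Ioi (0 : ℝ)).indicator (1 : ℝ → ℝ)) :=
      measurable_one.indicator measurableSet_Ioi
    exact (ha.indicator (measurableSet_slab1 T)).add
      (((hi.comp (measurable_const.sub measurable_fst)).sub (hi.comp measurable_fst)).const_mul B)
  have hi01 : ∀ t, 0 ≤ (Ioi (0 : ℝ)).indicator (1 : ℝ → ℝ) t ∧
      (Ioi (0 : ℝ)).indicator (1 : ℝ → ℝ) t ≤ 1 := fun t =>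
    ⟨indicator_nonneg (fun _ _ => zero_le_one) _, indicator_le_self' (fun _ _ => zero_le_one) _⟩
  have hbdd : ∀ p, |slabExtension T B a p| ≤ 2 * B := by
    intro p
    refine (abs_add_le _ _).trans ?_
    have h1 : |(Slab1 T).indicator a p| ≤ B := (norm_indicator_le_norm_self a p).trans (haB p)
    have h2 : |B * ((Ioi (0 : ℝ)).indicator (1 : ℝ → ℝ) (T - p.1)
        - (Ioi (0 : ℝ)).indicator 1 p.1)| ≤ B := by
      rw [abs_mul, abs_of_nonneg hB]
      refine mul_le_of_le_one_right hB (abs_le.2 ?_)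
      constructor <;> linarith [hi01 (T - p.1), hi01 p.1]
    linarith
  obtain ⟨μ, hμ, h⟩ := exists_measure_of_integral_gradPairing_nonneg hmeas
    (hb.indicator (measurableSet_slab1 T)) hbdd
    (fun p => ((norm_indicator_le_norm_self b p).trans (hbB p)).trans (by linarith))
    fun φ hφ hc h0 => integral_gradPairing_slabExtension_nonneg ha hb haB hbB hpos hφ hc h0
  refine ⟨μ, hμ, fun φ hφ => ?_⟩
  rw [← h φ hφ.1 hφ.2.1, ← integral_indicator (measurableSet_slab1 T)]
  congr 1; ext p
  by_cases hp : p ∈ Slab1 T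
  · have h1 : p.1 ∈ Ioi (0 : ℝ) := hp.1
    have h2 : T - p.1 ∈ Ioi (0 : ℝ) := sub_pos.2 hp.2
    simp [gradPairing, slabExtension, indicator_of_mem hp, indicator_of_mem h1,
      indicator_of_mem h2]
  · have : fderiv ℝ φ p = 0 := image_eq_zero_of_notMem_tsupport fun h' =>
      hp (hφ.2.2 (tsupport_fderiv_subset ℝ h'))
    simp [gradPairing, this, indicator_of_notMem hp]

/-- The difference of two locally finite measures is a locally finite signed measure. -/
lemma exists_locSigned_integral_eq_sub (μ ν : Measure (ℝ × ℝ)) [IsLocallyFiniteMeasure μ]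
    [IsLocallyFiniteMeasure ν] :
    ∃ κ : LocSigned (ℝ × ℝ), ∀ φ : ℝ × ℝ → ℝ, Continuous φ → HasCompactSupport φ →
      κ.integral φ = (∫ p, φ p ∂μ) - ∫ p, φ p ∂ν := by
  let τ := μ + ν
  let f := μ.rnDeriv τ
  let g := ν.rnDeriv τ
  have hf : Measurable f := Measure.measurable_rnDeriv _ _
  have hg : Measurable g := Measure.measurable_rnDeriv _ _
  have hμ : τ.withDensity f = μ :=
    Measure.withDensity_rnDeriv_eq _ _ (Measure.absolutelyContinuous_of_le (Measure.le_add_right le_rfl))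
  have hν : τ.withDensity g = ν :=
    Measure.withDensity_rnDeriv_eq _ _ (Measure.absolutelyContinuous_of_le (Measure.le_add_left le_rfl))
  have hle₁ : τ.withDensity (f - g) ≤ μ :=
    (withDensity_mono (Eventually.of_forall fun p => tsub_le_self)).trans_eq hμ
  have hle₂ : τ.withDensity (g - f) ≤ ν :=
    (withDensity_mono (Eventually.of_forall fun p => tsub_le_self)).trans_eq hν
  have lf₁ : IsLocallyFiniteMeasure (τ.withDensity (f - g)) :=
    Measure.isLocallyFiniteMeasure_of_le hle₁
  have lf₂ : IsLocallyFiniteMeasure (τ.withDensity (g - f)) :=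
    Measure.isLocallyFiniteMeasure_of_le hle₂
  have hsum : τ.withDensity (f - g) + ν = τ.withDensity (g - f) + μ := by
    suffices τ.withDensity (f - g) + τ.withDensity g = τ.withDensity (g - f) + τ.withDensity f by
      rwa [hμ, hν] at this
    rw [← withDensity_add_left (hf.sub hg), ← withDensity_add_left (hg.sub hf)]
    congr 1; ext p
    simp only [Pi.add_apply, Pi.sub_apply, tsub_add_eq_max, max_comm]
  refine ⟨⟨τ.withDensity (f - g), τ.withDensity (g - f), lf₁, lf₂, ?_⟩, fun φ hφ hc => ?_⟩
  · refine ⟨{p | f p ≤ g p}, measurableSet_le hf hg, ?_, ?_⟩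
    · rw [withDensity_apply _ (measurableSet_le hf hg)]
      refine (setLIntegral_congr_fun (measurableSet_le hf hg) (g := fun _ => 0) fun p hp => ?_).trans
        (by simp)
      exact tsub_eq_zero_of_le hp
    · rw [withDensity_apply _ (measurableSet_le hf hg).compl]
      refine (setLIntegral_congr_fun (measurableSet_le hf hg).compl (g := fun _ => 0)
        fun p hp => ?_).trans (by simp)
      exact tsub_eq_zero_of_le (le_of_not_ge hp)
  · have hi : ∀ (κ : Measure (ℝ × ℝ)) [IsLocallyFiniteMeasure κ], Integrable φ κ := fun κ _ =>
      hφ.integrable_of_hasCompactSupport hc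
    have := congrArg (fun κ => ∫ p, φ p ∂κ) hsum
    simp only [integral_add_measure (hi _) (hi _)] at this
    simp only [LocSigned.integral]
    linarith

/-- The Riemann invariants `m / ρ + σ ρ`, for `σ = ± 1`, as functions of the state. -/
def riemannInv (σ : ℝ) (p : ℝ × ℝ) : ℝ := p.2 / p.1 + σ * p.1

/-- The total energy `m² / (2 ρ) + ρ³ / 6`, written in Riemann invariants. -/
def eulerEnergy (p : ℝ × ℝ) : ℝ := (riemannInv 1 p ^ 3 - riemannInv (-1) p ^ 3) / 12

/-- The flux of the total energy, written in Riemann invariants. -/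
def eulerEnergyFlux (p : ℝ × ℝ) : ℝ := (riemannInv 1 p ^ 4 - riemannInv (-1) p ^ 4) / 16

lemma kset_eq_prod {c M : ℝ} (hc : 0 < c) : Kset c M = Icc c M ×ˢ Icc (-M) M := by
  ext p
  simp only [Kset, mem_ofPred_eq, mem_prod, mem_Icc, Prod.norm_def, sup_le_iff, Real.norm_eq_abs,
    abs_le]
  constructor
  · rintro ⟨⟨h1, h2⟩, h3⟩
    exact ⟨⟨h3, h1.2⟩, h2⟩
  · rintro ⟨h1, h2⟩
    exact ⟨⟨⟨by linarith [h1.1, h1.2], h1.2⟩, h2⟩, h1.1⟩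

lemma convex_kset {c M : ℝ} (hc : 0 < c) : Convex ℝ (Kset c M) := by
  rw [kset_eq_prod hc]
  exact (convex_Icc _ _).prod (convex_Icc _ _)

lemma isCompact_kset {c M : ℝ} (hc : 0 < c) : IsCompact (Kset c M) := by
  rw [kset_eq_prod hc]
  exact isCompact_Icc.prod isCompact_Icc

lemma uniqueDiffOn_kset {c M : ℝ} (hc : 0 < c) (hcM : c < M) : UniqueDiffOn ℝ (Kset c M) := by
  rw [kset_eq_prod hc]
  exact (uniqueDiffOn_Icc hcM).prod (uniqueDiffOn_Icc (by linarith))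

lemma fst_ne_zero_of_mem_kset {c M : ℝ} (hc : 0 < c) {p : ℝ × ℝ} (hp : p ∈ Kset c M) : p.1 ≠ 0 :=
  (hc.trans_le hp.2).ne'

lemma contDiffOn_riemannInv (σ : ℝ) {c M : ℝ} (hc : 0 < c) :
    ContDiffOn ℝ 2 (riemannInv σ) (Kset c M) := by
  unfold riemannInv
  exact (contDiffOn_snd.div contDiffOn_fst fun p hp => fst_ne_zero_of_mem_kset hc hp).add
    (contDiffOn_const.mul contDiffOn_fst)

lemma contDiffOn_eulerEnergy {c M : ℝ} (hc : 0 < c) : ContDiffOn ℝ 2 eulerEnergy (Kset c M) :=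
  (((contDiffOn_riemannInv 1 hc).pow 3).sub ((contDiffOn_riemannInv (-1) hc).pow 3)).div_const _

lemma contDiffOn_eulerEnergyFlux {c M : ℝ} (hc : 0 < c) :
    ContDiffOn ℝ 2 eulerEnergyFlux (Kset c M) :=
  (((contDiffOn_riemannInv 1 hc).pow 4).sub ((contDiffOn_riemannInv (-1) hc).pow 4)).div_const _

lemma hasFDerivAt_riemannInv (σ : ℝ) {p : ℝ × ℝ} (hp : p.1 ≠ 0) :
    HasFDerivAt (riemannInv σ) ((p.1)⁻¹ • ContinuousLinearMap.snd ℝ ℝ ℝ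
      + (-p.2 / p.1 ^ 2 + σ) • ContinuousLinearMap.fst ℝ ℝ ℝ) p := by
  have h1 : HasFDerivAt Prod.fst (ContinuousLinearMap.fst ℝ ℝ ℝ) p := hasFDerivAt_fst
  have h2 : HasFDerivAt Prod.snd (ContinuousLinearMap.snd ℝ ℝ ℝ) p := hasFDerivAt_snd
  have h := (h2.mul ((hasDerivAt_inv hp).comp_hasFDerivAt p h1)).add (h1.const_mul σ)
  refine (h.congr_fderiv ?_).congr_of_eventuallyEq (Eventually.of_forall fun q => ?_)
  · ext <;> simp
    ring
  · simp [riemannInv, div_eq_mul_inv]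

lemma fderiv_eulerFlux_apply {p : ℝ × ℝ} (hp : p.1 ≠ 0) (v : ℝ × ℝ) :
    fderiv ℝ eulerFlux p v
      = (v.2, 2 * p.2 / p.1 * v.2 + (-p.2 ^ 2 / p.1 ^ 2 + p.1 ^ 2) * v.1) := by
  have h1 : HasFDerivAt Prod.fst (ContinuousLinearMap.fst ℝ ℝ ℝ) p := hasFDerivAt_fst
  have h2 : HasFDerivAt Prod.snd (ContinuousLinearMap.snd ℝ ℝ ℝ) p := hasFDerivAt_snd
  have h := h2.prodMk (((h2.pow 2).mul ((hasDerivAt_inv hp).comp_hasFDerivAt p h1)).add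
    ((h1.pow 3).const_mul (1 / 3)))
  have h' : HasFDerivAt eulerFlux _ p := h.congr_of_eventuallyEq (Eventually.of_forall fun q => by
    simp [eulerFlux, div_eq_mul_inv, mul_comm (q.1 ^ 3)])
  rw [h'.fderiv]
  simp
  field_simp
  ring

/-- `(η, Q)` satisfies the compatibility relation `∇Q = ∇η · Df` of entropy pairs at `p`. -/
def IsEulerPairAt (η Q : ℝ × ℝ → ℝ) (p : ℝ × ℝ) : Prop :=
  ∃ L, HasFDerivAt η L p ∧ HasFDerivAt Q (L.comp (fderiv ℝ eulerFlux p)) p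

lemma IsEulerPairAt.add {η₁ Q₁ η₂ Q₂ : ℝ × ℝ → ℝ} {p : ℝ × ℝ} (h₁ : IsEulerPairAt η₁ Q₁ p)
    (h₂ : IsEulerPairAt η₂ Q₂ p) :
    IsEulerPairAt (fun p => η₁ p + η₂ p) (fun p => Q₁ p + Q₂ p) p := by
  obtain ⟨L₁, a₁, b₁⟩ := h₁
  obtain ⟨L₂, a₂, b₂⟩ := h₂
  exact ⟨L₁ + L₂, a₁.add a₂, (b₁.add b₂).congr_fderiv (by ext <;> simp)⟩

lemma IsEulerPairAt.const_mul {η Q : ℝ × ℝ → ℝ} {p : ℝ × ℝ} (h : IsEulerPairAt η Q p) (C : ℝ) :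
    IsEulerPairAt (fun p => C * η p) (fun p => C * Q p) p := by
  obtain ⟨L, a, b⟩ := h
  exact ⟨C • L, a.const_mul C, (b.const_mul C).congr_fderiv (by ext <;> simp)⟩

/-- An entropy pair for the Burgers equation gives an entropy pair of the Euler system, by
composition with a Riemann invariant. -/
lemma isEulerPairAt_comp_riemannInv {σ : ℝ} (hσ : σ ^ 2 = 1) {g q : ℝ → ℝ} {g' : ℝ} {p : ℝ × ℝ}
    (hp : p.1 ≠ 0) (hg : HasDerivAt g g' (riemannInv σ p))
    (hq : HasDerivAt q (g' * riemannInv σ p) (riemannInv σ p)) :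
    IsEulerPairAt (fun p => g (riemannInv σ p)) (fun p => q (riemannInv σ p)) p := by
  have hR := hasFDerivAt_riemannInv σ hp
  refine ⟨_, hg.comp_hasFDerivAt p hR, (hq.comp_hasFDerivAt p hR).congr_fderiv ?_⟩
  refine ContinuousLinearMap.ext fun v => ?_
  simp only [ContinuousLinearMap.comp_apply, smul_apply, add_apply,
    fderiv_eulerFlux_apply hp, smul_eq_mul, ContinuousLinearMap.coe_fst',
    ContinuousLinearMap.coe_snd', riemannInv]
  field_simp
  linear_combination g' * p.1 ^ 4 * v.1 * hσ

lemma isEulerPairAt_eulerEnergy {p : ℝ × ℝ} (hp : p.1 ≠ 0) :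
    IsEulerPairAt eulerEnergy eulerEnergyFlux p := by
  have h : ∀ σ : ℝ, σ ^ 2 = 1 →
      IsEulerPairAt (fun p => riemannInv σ p ^ 3) (fun p => 3 / 4 * riemannInv σ p ^ 4) p :=
    fun σ hσ => isEulerPairAt_comp_riemannInv hσ (g := fun v => v ^ 3)
      (q := fun v => 3 / 4 * v ^ 4) hp (hasDerivAt_pow 3 _)
      (((hasDerivAt_pow 4 _).const_mul (3 / 4)).congr_deriv (by norm_num; ring))
  have := ((h 1 (by norm_num)).const_mul (1 / 12)).add
    ((h (-1) (by norm_num)).const_mul (-1 / 12))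
  convert this using 1 <;> ext p <;> simp only [eulerEnergy, eulerEnergyFlux] <;> ring

/-- Velocity part of the derivative of the Riemann invariants along the line `t ↦ x + t v`. -/
def lineSlope (x v : ℝ × ℝ) (t : ℝ) : ℝ :=
  (v.2 * (x.1 + t * v.1) - v.1 * (x.2 + t * v.2)) / (x.1 + t * v.1) ^ 2

lemma hasDerivAt_riemannInv_line (σ : ℝ) {x v : ℝ × ℝ} {t : ℝ} (h : x.1 + t * v.1 ≠ 0) :
    HasDerivAt (fun t => riemannInv σ (x + t • v)) (lineSlope x v t + σ * v.1) t := by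
  have h1 : HasDerivAt (fun t => x.1 + t * v.1) v.1 t := by
    simpa using ((hasDerivAt_id t).mul_const v.1).const_add x.1
  have h2 : HasDerivAt (fun t => x.2 + t * v.2) v.2 t := by
    simpa using ((hasDerivAt_id t).mul_const v.2).const_add x.2
  refine ((h2.div h1 h).add (h1.const_mul σ)).congr_deriv ?_
  rw [lineSlope]
  ring

lemma hasDerivAt_lineSlope {x v : ℝ × ℝ} {t : ℝ} (h : x.1 + t * v.1 ≠ 0) :
    HasDerivAt (lineSlope x v) (-2 * v.1 * lineSlope x v t / (x.1 + t * v.1)) t := by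
  have h1 : HasDerivAt (fun t => x.1 + t * v.1) v.1 t := by
    simpa using ((hasDerivAt_id t).mul_const v.1).const_add x.1
  have h2 : HasDerivAt (fun t => x.2 + t * v.2) v.2 t := by
    simpa using ((hasDerivAt_id t).mul_const v.2).const_add x.2
  refine (((h1.const_mul v.2).sub (h2.const_mul v.1)).div (h1.pow 2) (pow_ne_zero 2 h)).congr_deriv
    ?_
  simp only [lineSlope, Pi.sub_apply, Pi.pow_apply, Nat.cast_ofNat, Nat.add_one_sub_one, pow_one]
  generalize x.2 + t * v.2 = m
  generalize x.1 + t * v.1 = ρ at *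
  field_simp
  ring

/-- Second derivative along lines of a function of a Riemann invariant. -/
lemma hasDerivAt_comp_riemannInv_line {σ : ℝ} {g g' g'' : ℝ → ℝ} (hg : ∀ v, HasDerivAt g (g' v) v)
    (hg' : ∀ v, HasDerivAt g' (g'' v) v) {x v : ℝ × ℝ} {t : ℝ} (h : x.1 + t * v.1 ≠ 0) :
    HasDerivAt (fun t => g (riemannInv σ (x + t • v)))
      (g' (riemannInv σ (x + t • v)) * (lineSlope x v t + σ * v.1)) t ∧
    HasDerivAt (fun t => g' (riemannInv σ (x + t • v)) * (lineSlope x v t + σ * v.1))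
      (g'' (riemannInv σ (x + t • v)) * (lineSlope x v t + σ * v.1) ^ 2
        - g' (riemannInv σ (x + t • v)) * (2 * v.1 * lineSlope x v t / (x.1 + t * v.1))) t := by
  have hR := hasDerivAt_riemannInv_line σ h
  refine ⟨(hg _).comp t hR, ((((hg' _).comp t hR).mul
    ((hasDerivAt_lineSlope h).add_const (σ * v.1)))).congr_deriv ?_⟩
  simp only [Function.comp_apply]
  ring

/-- Adding a large multiple of the energy makes any function of a Riemann invariant convex. -/
lemma exists_convexOn_add_mul_eulerEnergy {c M : ℝ} (hc : 0 < c) {σ : ℝ} (hσ : σ ^ 2 = 1)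
    {g : ℝ → ℝ} (hg : ContDiff ℝ 2 g) :
    ∃ C₀ : ℝ, ∀ C, C₀ ≤ C →
      ConvexOn ℝ (Kset c M) fun p => g (riemannInv σ p) + C * eulerEnergy p := by
  have hg₁ : ContDiff ℝ 1 (deriv g) := ((contDiff_succ_iff_deriv (n := 1)).1 hg).2.2
  have hd₁ : ∀ v, HasDerivAt g (deriv g v) v := fun v =>
    (hg.differentiable (by simp) v).hasDerivAt
  have hd₂ : ∀ v, HasDerivAt (deriv g) (deriv (deriv g) v) v := fun v =>
    (hg₁.differentiable (by simp) v).hasDerivAt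
  have hRc : ContinuousOn (riemannInv σ) (Kset c M) := (contDiffOn_riemannInv σ hc).continuousOn
  obtain ⟨B₁, hB₁⟩ := (isCompact_kset (M := M) hc).exists_bound_of_continuousOn
    (hg₁.continuous.comp_continuousOn hRc)
  obtain ⟨B₂, hB₂⟩ := (isCompact_kset (M := M) hc).exists_bound_of_continuousOn
    ((hg₁.continuous_deriv (by simp)).comp_continuousOn hRc)
  refine ⟨(2 * B₂ + B₁ / c) / c, fun C hC => ⟨convex_kset hc, fun x hx y hy a b ha hb hab => ?_⟩⟩
  set v := y - x with hv
  have hmem : ∀ t ∈ Icc (0 : ℝ) 1, x + t • v ∈ Kset c M := fun t ht => by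
    have := convex_kset hc hx hy (sub_nonneg.2 ht.2) ht.1 (by ring)
    convert this using 1
    rw [hv]; module
  have hne : ∀ t ∈ Icc (0 : ℝ) 1, x.1 + t * v.1 ≠ 0 := fun t ht =>
    fst_ne_zero_of_mem_kset hc (hmem t ht)
  have hcube : ∀ u : ℝ, HasDerivAt (fun u : ℝ => u ^ 3) (3 * u ^ 2) u := fun u => by
    simpa using hasDerivAt_pow 3 u
  have hsq : ∀ u : ℝ, HasDerivAt (fun u : ℝ => 3 * u ^ 2) (6 * u) u := fun u =>
    ((hasDerivAt_pow 2 u).const_mul 3).congr_deriv (by simp; ring)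
  let h : ℝ → ℝ := fun t => g (riemannInv σ (x + t • v)) + C * eulerEnergy (x + t • v)
  have hconv : ConvexOn ℝ (Icc (0 : ℝ) 1) h := by
    have hder := fun t (ht : t ∈ Icc (0 : ℝ) 1) =>
      And.intro (hasDerivAt_comp_riemannInv_line (σ := σ) hd₁ hd₂ (hne t ht))
        (And.intro (hasDerivAt_comp_riemannInv_line (σ := 1) hcube hsq (hne t ht))
          (hasDerivAt_comp_riemannInv_line (σ := -1) hcube hsq (hne t ht)))
    have hfst : ∀ t ∈ Icc (0 : ℝ) 1, HasDerivAt h _ t := fun t ht =>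
      (hder t ht).1.1.add ((((hder t ht).2.1.1.sub (hder t ht).2.2.1).div_const 12).const_mul C)
    refine convexOn_of_hasDerivWithinAt2_nonneg (convex_Icc 0 1)
      (fun t ht => (hfst t ht).continuousAt.continuousWithinAt)
      (fun t ht => (hfst t (interior_subset ht)).hasDerivWithinAt)
      (fun t ht => (((hder t (interior_subset ht)).1.2.add
        ((((hder t (interior_subset ht)).2.1.2.sub
          (hder t (interior_subset ht)).2.2.2).div_const 12).const_mul C))).hasDerivWithinAt)
      fun t ht => ?_
    have hm := hmem t (interior_subset ht)
    have h1 := abs_le.1 (hB₁ _ hm)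
    have h2 := abs_le.1 (hB₂ _ hm)
    have hρ : c ≤ x.1 + t * v.1 := hm.2
    simp only [Function.comp_apply] at h1 h2
    have hR : ∀ τ : ℝ, riemannInv τ (x + t • v)
        = (x.2 + t * v.2) / (x.1 + t * v.1) + τ * (x.1 + t * v.1) := fun τ => rfl
    rw [hR 1, hR (-1)]
    generalize deriv g (riemannInv σ (x + t • v)) = d₁ at *
    generalize deriv (deriv g) (riemannInv σ (x + t • v)) = d₂ at *
    generalize lineSlope x v t = s at *
    generalize x.2 + t * v.2 = m at *
    generalize x.1 + t * v.1 = ρ at *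
    generalize v.1 = e at *
    have hρ0 : 0 < ρ := hc.trans_le hρ
    have hB1 : 0 ≤ B₁ := by linarith [h1.1, h1.2]
    have hB2 : 0 ≤ B₂ := by linarith [h2.1, h2.2]
    have hen : C * ((6 * (m / ρ + 1 * ρ) * (s + 1 * e) ^ 2
          - 3 * (m / ρ + 1 * ρ) ^ 2 * (2 * e * s / ρ)
          - (6 * (m / ρ + -1 * ρ) * (s + -1 * e) ^ 2
            - 3 * (m / ρ + -1 * ρ) ^ 2 * (2 * e * s / ρ))) / 12) = C * ρ * (s ^ 2 + e ^ 2) := by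
      field_simp
      ring
    rw [hen]
    have hse : 0 ≤ s ^ 2 + e ^ 2 := by positivity
    have e1 : -(2 * B₂ * (s ^ 2 + e ^ 2)) ≤ d₂ * (s + σ * e) ^ 2 := by
      have : (s + σ * e) ^ 2 ≤ 2 * (s ^ 2 + e ^ 2) := by
        nlinarith [sq_nonneg (s - σ * e)]
      nlinarith [mul_le_mul_of_nonneg_left this hB2,
        mul_nonneg (by linarith [h2.1] : 0 ≤ d₂ + B₂) (sq_nonneg (s + σ * e))]
    have e2 : d₁ * (2 * e * s / ρ) ≤ B₁ / c * (s ^ 2 + e ^ 2) := by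
      have i1 : d₁ * (2 * e * s) ≤ B₁ * (s ^ 2 + e ^ 2) := by
        nlinarith [mul_nonneg (by linarith [h1.1] : 0 ≤ d₁ + B₁) (sq_nonneg (s - e)),
          mul_nonneg (by linarith [h1.2] : 0 ≤ B₁ - d₁) (sq_nonneg (s + e))]
      calc d₁ * (2 * e * s / ρ) = d₁ * (2 * e * s) / ρ := by ring
        _ ≤ B₁ * (s ^ 2 + e ^ 2) / ρ := by gcongr
        _ ≤ B₁ * (s ^ 2 + e ^ 2) / c := by gcongr
        _ = _ := by ring
    have e3 : (2 * B₂ + B₁ / c) * (s ^ 2 + e ^ 2) ≤ C * ρ * (s ^ 2 + e ^ 2) := by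
      have hC0 : 0 ≤ C := le_trans (by positivity) hC
      have : 2 * B₂ + B₁ / c ≤ C * c := (div_le_iff₀ hc).1 hC
      gcongr
      exact this.trans (by gcongr)
    linarith
  have key := hconv.2 (left_mem_Icc.2 zero_le_one) (right_mem_Icc.2 zero_le_one) ha hb hab
  have e1 : x + (a • (0 : ℝ) + b • (1 : ℝ)) • v = a • x + b • y := by
    rw [eq_sub_of_add_eq hab, hv]
    module
  simp only [h] at key
  rw [e1] at key
  simpa [hv] using key

/-- Along an entropy solution, a convex entropy of the form `g (R) + C E` is dissipated by a
measure. -/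
lemma exists_measure_entropy_dissipation {c M T : ℝ} (hc : 0 < c) (hcM : c < M)
    {U : ℝ × ℝ → ℝ × ℝ} (hU : IsEntropySolK c M T U) {σ : ℝ} (hσ : σ ^ 2 = 1) {g q : ℝ → ℝ}
    (hg : ContDiff ℝ 2 g) (hq : ContDiff ℝ 2 q) (hgq : ∀ v, deriv q v = deriv g v * v) {C : ℝ}
    (hconv : ConvexOn ℝ (Kset c M) fun p => g (riemannInv σ p) + C * eulerEnergy p) :
    ∃ μ : Measure (ℝ × ℝ), IsLocallyFiniteMeasure μ ∧
      ∀ φ : ℝ × ℝ → ℝ, IsTestFun (Slab1 T) φ →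
        Integrable (gradPairing (fun p => g (riemannInv σ (U p)) + C * eulerEnergy (U p))
          (fun p => q (riemannInv σ (U p)) + C * eulerEnergyFlux (U p)) φ) ∧
        ∫ p in Slab1 T, gradPairing
          (fun p => g (riemannInv σ (U p)) + C * eulerEnergy (U p))
          (fun p => q (riemannInv σ (U p)) + C * eulerEnergyFlux (U p)) φ p = ∫ p, φ p ∂μ := by
  obtain ⟨hmeas, hK, -, hent⟩ := hU
  have hη : ContDiffOn ℝ 2 (fun p => g (riemannInv σ p) + C * eulerEnergy p) (Kset c M) :=
    (hg.comp_contDiffOn (contDiffOn_riemannInv σ hc)).add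
      (contDiffOn_const.mul (contDiffOn_eulerEnergy hc))
  have hQ : ContDiffOn ℝ 2 (fun p => q (riemannInv σ p) + C * eulerEnergyFlux p) (Kset c M) :=
    (hq.comp_contDiffOn (contDiffOn_riemannInv σ hc)).add
      (contDiffOn_const.mul (contDiffOn_eulerEnergyFlux hc))
  have hmR : ∀ τ, Measurable (riemannInv τ) := fun τ =>
    (measurable_snd.div measurable_fst).add (measurable_fst.const_mul τ)
  have hmE : Measurable eulerEnergy :=
    (((hmR 1).pow_const 3).sub ((hmR (-1)).pow_const 3)).div_const 12
  have hmF : Measurable eulerEnergyFlux :=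
    (((hmR 1).pow_const 4).sub ((hmR (-1)).pow_const 4)).div_const 16
  obtain ⟨B₁, hB₁⟩ := (isCompact_kset hc).exists_bound_of_continuousOn hη.continuousOn
  obtain ⟨B₂, hB₂⟩ := (isCompact_kset hc).exists_bound_of_continuousOn hQ.continuousOn
  have hmη : Measurable fun p => g (riemannInv σ (U p)) + C * eulerEnergy (U p) :=
    ((hg.continuous.measurable.comp (hmR σ)).add (hmE.const_mul C)).comp hmeas
  have hmQ : Measurable fun p => q (riemannInv σ (U p)) + C * eulerEnergyFlux (U p) :=
    ((hq.continuous.measurable.comp (hmR σ)).add (hmF.const_mul C)).comp hmeas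
  have hbη : ∀ p, |g (riemannInv σ (U p)) + C * eulerEnergy (U p)| ≤ max B₁ B₂ := fun p =>
    (hB₁ _ (hK p)).trans (le_max_left _ _)
  have hbQ : ∀ p, |q (riemannInv σ (U p)) + C * eulerEnergyFlux (U p)| ≤ max B₁ B₂ := fun p =>
    (hB₂ _ (hK p)).trans (le_max_right _ _)
  suffices hpair : ∀ p ∈ Kset c M,
      fderivWithin ℝ (fun p => q (riemannInv σ p) + C * eulerEnergyFlux p) (Kset c M) p
        = (fderivWithin ℝ (fun p => g (riemannInv σ p) + C * eulerEnergy p) (Kset c M) p).comp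
          (fderiv ℝ eulerFlux p) by
    obtain ⟨μ, hμ, h⟩ := exists_measure_of_integral_gradPairing_slab1_nonneg hmη hmQ hbη hbQ
      (hent _ _ hη hconv hQ hpair)
    exact ⟨μ, hμ, fun φ hφ => ⟨integrable_gradPairing hmη hmQ hbη hbQ hφ.1 hφ.2.1, h φ hφ⟩⟩
  intro p hp
  have hp0 := fst_ne_zero_of_mem_kset hc hp
  obtain ⟨L, h₁, h₂⟩ := (isEulerPairAt_comp_riemannInv hσ hp0
    (hg.differentiable (by simp) _).hasDerivAt
    ((hq.differentiable (by simp) _).hasDerivAt.congr_deriv (hgq _))).add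
    ((isEulerPairAt_eulerEnergy hp0).const_mul C)
  have hu := uniqueDiffOn_kset hc hcM p hp
  rw [h₁.hasFDerivWithinAt.fderivWithin hu, h₂.hasFDerivWithinAt.fderivWithin hu]

lemma isQuasiEntropySol1_riemannInv {c M T : ℝ} (hc : 0 < c) (hcM : c < M)
    {U : ℝ × ℝ → ℝ × ℝ} (hU : IsEntropySolK c M T U) {σ : ℝ} (hσ : σ ^ 2 = 1) :
    IsQuasiEntropySol1 (Slab1 T) (fun v => v ^ 2 / 2) fun p => riemannInv σ (U p) := by
  intro g q ⟨hg, hq, hgq⟩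
  have hgq' : ∀ v, deriv q v = deriv g v * v := fun v => by
    rw [hgq v]
    congr 1
    simp
  have hg₁ : ContDiff ℝ 1 (deriv g) := ((contDiff_succ_iff_deriv (n := 1)).1 hg).2.2
  have hq₂ : ContDiff ℝ 2 q := by
    refine (contDiff_succ_iff_deriv (n := 1)).2 ⟨hq, by simp, ?_⟩
    rw [funext hgq']
    exact hg₁.mul contDiff_id
  obtain ⟨C₁, hC₁⟩ := exists_convexOn_add_mul_eulerEnergy (M := M) hc hσ hg
  obtain ⟨C₂, hC₂⟩ := exists_convexOn_add_mul_eulerEnergy (M := M) (g := fun _ => 0) hc hσ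
    contDiff_const
  obtain ⟨μ, hμ, hμ'⟩ := exists_measure_entropy_dissipation hc hcM hU hσ hg hq₂ hgq'
    (hC₁ (max C₁ C₂) (le_max_left _ _))
  obtain ⟨ν, hν, hν'⟩ := exists_measure_entropy_dissipation (q := fun _ => 0) hc hcM hU hσ
    contDiff_const contDiff_const (by simp) (hC₂ (max C₁ C₂) (le_max_right _ _))
  obtain ⟨κ, hκ⟩ := exists_locSigned_integral_eq_sub ν μ
  refine ⟨κ, fun φ hφ => ?_⟩
  obtain ⟨i₁, e₁⟩ := hμ' φ hφ
  obtain ⟨i₂, e₂⟩ := hν' φ hφ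
  rw [hκ φ hφ.1.continuous hφ.2.1, ← e₁, ← e₂, neg_sub,
    ← integral_sub i₁.integrableOn i₂.integrableOn]
  congr 1; ext p
  simp only [gradPairing]
  ring

/-- Differentiation of the pairing of a bounded function with a translated test function. -/
lemma hasDerivAt_integral_mul_translate {k : ℝ × ℝ → ℝ} (hk : Measurable k) {B : ℝ}
    (hB : ∀ p, |k p| ≤ B) {ψ : ℝ × ℝ → ℝ} (hψ : ContDiff ℝ ∞ ψ) (hc : HasCompactSupport ψ)
    (v : ℝ × ℝ) (s : ℝ) :
    HasDerivAt (fun s => ∫ p, k p * ψ (p + s • v)) (∫ p, k p * fderiv ℝ ψ (p + s • v) v) s := by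
  have hB0 : 0 ≤ B := (abs_nonneg _).trans (hB 0)
  have hc' := hasCompactSupport_fderiv_apply_const hc v
  have hcont := continuous_fderiv_apply_const hψ v
  obtain ⟨A, hA⟩ := hc'.exists_bound_of_continuous hcont
  obtain ⟨R, hR⟩ := hc'.isCompact.isBounded.subset_closedBall (0 : ℝ × ℝ)
  have hA0 : 0 ≤ A := (norm_nonneg _).trans (hA 0)
  let K : Set (ℝ × ℝ) := Metric.closedBall 0 (R + (|s| + 1) * ‖v‖)
  refine (hasDerivAt_integral_of_dominated_loc_of_deriv_le (Metric.ball_mem_nhds s one_pos)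
    (F := fun s p => k p * ψ (p + s • v)) (F' := fun s p => k p * fderiv ℝ ψ (p + s • v) v)
    (bound := K.indicator fun _ => B * A)
    (Eventually.of_forall fun s' => ?_) ?_ ?_ ?_ ?_ ?_).2
  · exact hk.aestronglyMeasurable.mul (hψ.continuous.comp (by fun_prop)).aestronglyMeasurable
  · exact ((hψ.continuous.integrable_of_hasCompactSupport hc).comp_add_right (s • v)).bdd_mul
      hk.aestronglyMeasurable (Eventually.of_forall hB)
  · exact hk.aestronglyMeasurable.mul (hcont.comp (by fun_prop)).aestronglyMeasurable
  · refine Eventually.of_forall fun p s' hs' => ?_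
    by_cases hp : p + s' • v ∈ tsupport fun p => fderiv ℝ ψ p v
    · have hpK : p ∈ K := by
        have h1 : ‖p + s' • v‖ ≤ R := by simpa using hR hp
        have h2 : |s'| ≤ |s| + 1 := by
          have h3 : |s' - s| < 1 := hs'
          have := abs_add_le (s' - s) s
          rw [sub_add_cancel] at this
          linarith
        have h4 : ‖p‖ ≤ ‖p + s' • v‖ + ‖s' • v‖ := by
          simpa using norm_sub_le (p + s' • v) (s' • v)
        rw [norm_smul, Real.norm_eq_abs] at h4
        have h5 : |s'| * ‖v‖ ≤ (|s| + 1) * ‖v‖ := by gcongr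
        simp only [K, mem_closedBall_zero_iff]
        linarith
      rw [indicator_of_mem hpK, norm_mul]
      exact mul_le_mul (hB p) (hA _) (norm_nonneg _) hB0
    · have : fderiv ℝ ψ (p + s' • v) v = 0 :=
        image_eq_zero_of_notMem_tsupport (f := fun p => fderiv ℝ ψ p v) hp
      simp only [this, mul_zero, norm_zero]
      exact indicator_nonneg (fun _ _ => by positivity) _
  · exact (integrable_indicator_iff measurableSet_closedBall).2
      (integrableOn_const (isCompact_closedBall _ _).measure_lt_top.ne)
  · refine Eventually.of_forall fun p s' _ => ?_
    have h1 : HasDerivAt (fun s : ℝ => p + s • v) v s' := by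
      simpa using ((hasDerivAt_id s').smul_const v).const_add p
    exact (((hψ.differentiable (by simp) _).hasFDerivAt.comp_hasDerivAt s' h1).const_mul (k p))

lemma IsTestFun.translate {Ω : Set (ℝ × ℝ)} {φ : ℝ × ℝ → ℝ} (hφ : ContDiff ℝ ∞ φ)
    (hc : HasCompactSupport φ) {w : ℝ × ℝ} (hw : ∀ p ∈ tsupport φ, p - w ∈ Ω) :
    IsTestFun Ω fun p => φ (p + w) := by
  refine ⟨hφ.comp (by fun_prop), hc.comp_homeomorph (Homeomorph.addRight w), fun p hp => ?_⟩
  have := hw (p + w) (tsupport_comp_subset_preimage φ (f := fun p => p + w) (by fun_prop) hp)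
  simpa using this

/-- A bounded function whose derivative in a direction vanishes in the sense of distributions is
locally invariant by translation in this direction, hence so is any function of it. -/
lemma setIntegral_comp_mul_fderiv_eq_zero {Ω : Set (ℝ × ℝ)} (hΩ : IsOpen Ω) {g : ℝ × ℝ → ℝ}
    (hg : Measurable g) {B : ℝ} (hB : ∀ p, |g p| ≤ B) {v : ℝ × ℝ}
    (h : ∀ φ, IsTestFun Ω φ → ∫ p in Ω, g p * fderiv ℝ φ p v = 0) {G : ℝ → ℝ} (hG : Continuous G)
    {φ : ℝ × ℝ → ℝ} (hφ : IsTestFun Ω φ) : ∫ p in Ω, G (g p) * fderiv ℝ φ p v = 0 := by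
  have hB0 : 0 ≤ B := (abs_nonneg _).trans (hB 0)
  let k := Ω.indicator g
  have hkm : Measurable k := hg.indicator hΩ.measurableSet
  have hkB : ∀ p, |k p| ≤ B := fun p => (norm_indicator_le_norm_self g p).trans (hB p)
  obtain ⟨A, hA⟩ := (isCompact_Icc (a := -B) (b := B)).exists_bound_of_continuousOn hG.continuousOn
  have hGB : ∀ p, |G (k p)| ≤ A := fun p => hA _ (abs_le.1 (hkB p))
  obtain ⟨δ, hδ, hδΩ⟩ := hφ.2.1.isCompact.exists_thickening_subset_open hΩ hφ.2.2
  have hδ2 : 0 < δ / 2 := half_pos hδ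
  set Ω' := Metric.thickening (δ / 2) (tsupport φ) with hΩ'
  have hmem : ∀ p ∈ Ω', ∀ w : ℝ × ℝ, ‖w‖ < δ / 2 → p - w ∈ Ω := fun p hp w hw => by
    obtain ⟨z, hz, hpz⟩ := Metric.mem_thickening_iff.1 hp
    refine hδΩ (Metric.mem_thickening_iff.2 ⟨z, hz, ?_⟩)
    have h1 : dist (p - w) p = ‖w‖ := by simp
    linarith [dist_triangle (p - w) p z]
  obtain ⟨ε, hε, hεv⟩ : ∃ ε : ℝ, 0 < ε ∧ ∀ s ∈ Ioo (-ε) ε, ‖s • v‖ < δ / 2 := by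
    refine ⟨δ / 2 / (‖v‖ + 1), by positivity, fun s hs => ?_⟩
    rw [norm_smul, Real.norm_eq_abs]
    have h1 := (lt_div_iff₀ (by positivity)).1 (abs_lt.2 hs)
    nlinarith [abs_nonneg s, norm_nonneg v]
  have hinv : ∀ s ∈ Ioo (-ε) ε, ∀ᵐ p, p ∈ Ω' → k (p - s • v) - k p = 0 := by
    intro s hs
    have hkt : Measurable fun p => k (p - s • v) := hkm.comp (measurable_id.sub_const _)
    refine Metric.isOpen_thickening.ae_eq_zero_of_integral_contDiff_smul_eq_zero ?_
      fun ψ hψ hc hsupp => ?_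
    · refine LocallyIntegrable.locallyIntegrableOn ?_ _
      refine (locallyIntegrable_const (B + B)).mono (hkt.sub hkm).aestronglyMeasurable
        (Eventually.of_forall fun p => ?_)
      rw [Real.norm_of_nonneg (add_nonneg hB0 hB0)]
      exact (norm_sub_le _ _).trans (add_le_add (hkB _) (hkB _))
    · have hder := hasDerivAt_integral_mul_translate hkm hkB hψ hc v
      have hzero : ∀ s ∈ Ioo (-ε) ε, ∫ p, k p * fderiv ℝ ψ (p + s • v) v = 0 := by
        intro s hs
        have := h _ (IsTestFun.translate hψ hc fun p hp => hmem p (hsupp hp) _ (hεv s hs))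
        rw [← integral_indicator hΩ.measurableSet] at this
        rw [← this]
        congr 1; ext p
        by_cases hp : p ∈ Ω <;> simp [k, hp, fderiv_comp_add_right]
      have hconst := isOpen_Ioo.is_const_of_deriv_eq_zero isPreconnected_Ioo
        (fun s _ => (hder s).differentiableAt.differentiableWithinAt)
        (fun s hs => (hder s).deriv.trans (hzero s hs)) hs
        (show (0 : ℝ) ∈ Ioo (-ε) ε from ⟨by linarith, hε⟩)
      have hψi := hψ.continuous.integrable_of_hasCompactSupport (μ := volume) hc
      have hshift : ∫ p, k p * ψ (p + s • v) = ∫ p, k (p - s • v) * ψ p := by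
        rw [← integral_add_right_eq_self (fun p => k (p - s • v) * ψ p) (s • v)]
        simp
      simp only [zero_smul, add_zero, hshift] at hconst
      have i1 : Integrable fun p => k (p - s • v) * ψ p :=
        hψi.bdd_mul hkt.aestronglyMeasurable (Eventually.of_forall fun p => hkB _)
      have i2 : Integrable fun p => k p * ψ p :=
        hψi.bdd_mul hkm.aestronglyMeasurable (Eventually.of_forall hkB)
      rw [← sub_eq_zero, ← integral_sub i1 i2] at hconst
      rw [← hconst]
      congr 1; ext p
      rw [smul_eq_mul]
      ring
  have hGm : Measurable fun p => G (k p) := hG.measurable.comp hkm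
  have hder := hasDerivAt_integral_mul_translate hGm hGB hφ.1 hφ.2.1 v 0
  have hloc : (fun s => ∫ p, G (k p) * φ (p + s • v)) =ᶠ[𝓝 (0 : ℝ)] fun _ => ∫ p, G (k p) * φ p := by
    filter_upwards [Ioo_mem_nhds (neg_lt_zero.2 hε) hε] with s hs
    rw [← integral_add_right_eq_self (fun p => G (k p) * φ p) (s • v)]
    have hs' : ∀ᵐ p, G (k (p - s • v)) * φ p = G (k p) * φ p := by
      filter_upwards [hinv s hs] with p hp
      by_cases hpφ : p ∈ tsupport φ
      · rw [sub_eq_zero.1 (hp (Metric.self_subset_thickening hδ2 _ hpφ))]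
      · rw [image_eq_zero_of_notMem_tsupport hpφ, mul_zero, mul_zero]
    rw [integral_add_right_eq_self (fun p => G (k p) * φ p) (s • v), ← integral_congr_ae hs',
      ← integral_add_right_eq_self (fun p => G (k (p - s • v)) * φ p) (s • v)]
    simp
  have hval := hder.unique ((hasDerivAt_const _ _).congr_of_eventuallyEq hloc)
  rw [← hval, ← integral_indicator hΩ.measurableSet]
  congr 1; ext p
  by_cases hp : p ∈ Ω
  · simp [k, hp]
  · have : fderiv ℝ φ p = 0 := image_eq_zero_of_notMem_tsupport fun h' =>
      hp (hφ.2.2 (tsupport_fderiv_subset ℝ h'))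
    simp [k, hp, this]

/-- When the density is forced to be constant, the momentum is constant and the Riemann invariants
are conserved. -/
lemma isQuasiEntropySol1_riemannInv_of_eq {M T : ℝ} (hM : 0 < M)
    {U : ℝ × ℝ → ℝ × ℝ} (hU : IsEntropySolK M M T U) (σ : ℝ) :
    IsQuasiEntropySol1 (Slab1 T) (fun v => v ^ 2 / 2) fun p => riemannInv σ (U p) := by
  rintro g q ⟨hg, hq, -⟩
  obtain ⟨hmeas, hK, hsol, -⟩ := hU
  have hρ : ∀ p, (U p).1 = M := fun p => by
    have := hK p
    rw [kset_eq_prod hM] at this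
    exact le_antisymm this.1.2 this.1.1
  have hm : ∀ p, |(U p).2| ≤ M := fun p => by
    have := hK p
    rw [kset_eq_prod hM] at this
    exact abs_le.2 this.2
  have hmm : Measurable fun p => (U p).2 := measurable_snd.comp hmeas
  have hbdd : ∀ {G : ℝ → ℝ}, Continuous G → ∀ {φ : ℝ × ℝ → ℝ}, IsTestFun (Slab1 T) φ →
      ∀ v, IntegrableOn (fun p => G (U p).2 * fderiv ℝ φ p v) (Slab1 T) := by
    intro G hG φ hφ v
    obtain ⟨A, hA⟩ := (isCompact_Icc (a := -M) (b := M)).exists_bound_of_continuousOn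
      hG.continuousOn
    exact ((integrable_fderiv_apply_const hφ.1 hφ.2.1 v).bdd_mul
      (hG.measurable.comp hmm).aestronglyMeasurable
      (Eventually.of_forall fun p => hA _ (abs_le.1 (hm p)))).integrableOn
  have ht : ∀ φ, IsTestFun (Slab1 T) φ → ∫ p in Slab1 T, fderiv ℝ φ p (1, 0) = 0 := by
    intro φ hφ
    have h := (integral_deriv_fst_mul (θ := fun _ => 1) contDiff_const hφ.1 hφ.2.1).2.2
    rw [setIntegral_eq_integral_of_forall_compl_eq_zero]
    · simpa using h
    · intro p hp
      have : fderiv ℝ φ p = 0 := image_eq_zero_of_notMem_tsupport fun h' =>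
        hp (hφ.2.2 (tsupport_fderiv_subset ℝ h'))
      simp [this]
  have hx : ∀ φ, IsTestFun (Slab1 T) φ → ∫ p in Slab1 T, (U p).2 * fderiv ℝ φ p (0, 1) = 0 := by
    intro φ hφ
    have h := (hsol φ hφ).1
    simp only [hρ] at h
    rwa [integral_add (hbdd (G := fun _ => M) continuous_const hφ _)
      (hbdd (G := fun u => u) continuous_id hφ _), integral_const_mul, ht φ hφ, mul_zero,
      zero_add] at h
  have hxG : ∀ {G : ℝ → ℝ}, Continuous G → ∀ φ, IsTestFun (Slab1 T) φ →
      ∫ p in Slab1 T, G (U p).2 * fderiv ℝ φ p (0, 1) = 0 := fun hG φ hφ =>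
    setIntegral_comp_mul_fderiv_eq_zero (isOpen_slab1 T) hmm hm hx hG hφ
  have htm : ∀ φ, IsTestFun (Slab1 T) φ →
      ∫ p in Slab1 T, (U p).2 * fderiv ℝ φ p (1, 0) = 0 := by
    intro φ hφ
    have hflux : Continuous fun u : ℝ => u ^ 2 / M + M ^ 3 / 3 := by fun_prop
    have h := (hsol φ hφ).2
    simp only [hρ] at h
    rwa [integral_add (hbdd (G := fun u => u) continuous_id hφ _) (hbdd hflux hφ _),
      hxG hflux φ hφ, add_zero] at h
  have htG : ∀ {G : ℝ → ℝ}, Continuous G → ∀ φ, IsTestFun (Slab1 T) φ →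
      ∫ p in Slab1 T, G (U p).2 * fderiv ℝ φ p (1, 0) = 0 := fun hG φ hφ =>
    setIntegral_comp_mul_fderiv_eq_zero (isOpen_slab1 T) hmm hm htm hG hφ
  obtain ⟨κ, hκ⟩ := exists_locSigned_integral_eq_sub 0 0
  refine ⟨κ, fun φ hφ => ?_⟩
  have hgc : Continuous fun u : ℝ => g (u / M + σ * M) := hg.continuous.comp (by fun_prop)
  have hqc : Continuous fun u : ℝ => q (u / M + σ * M) := hq.continuous.comp (by fun_prop)
  simp only [riemannInv, hρ]
  rw [hκ φ hφ.1.continuous hφ.2.1, integral_add (hbdd hgc hφ _) (hbdd hqc hφ _), htG hgc φ hφ,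
    hxG hqc φ hφ]
  simp

/-- The Riemann invariants `w = m/ρ - ρ` and `z = m/ρ + ρ` of an
entropy solution in `K` of the isentropic Euler system with `γ = 3` are quasi-entropy
solutions of the Burgers equation. -/
theorem statement12 (c M T : ℝ) (hc : 0 < c) (hcM : c ≤ M) (hT : 0 < T)
    (U : ℝ × ℝ → ℝ × ℝ) (hU : IsEntropySolK c M T U) :
    IsQuasiEntropySol1 (Slab1 T) (fun v => v ^ 2 / 2) (wInv U) ∧
    IsQuasiEntropySol1 (Slab1 T) (fun v => v ^ 2 / 2) (zInv U) := by
  have h : ∀ σ : ℝ, σ ^ 2 = 1 →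
      IsQuasiEntropySol1 (Slab1 T) (fun v => v ^ 2 / 2) fun p => riemannInv σ (U p) := by
    intro σ hσ
    rcases hcM.lt_or_eq with hlt | rfl
    · exact isQuasiEntropySol1_riemannInv hc hlt hU hσ
    · exact isQuasiEntropySol1_riemannInv_of_eq hc hU σ
  have hw : wInv U = fun p => riemannInv (-1) (U p) := by
    ext p
    simp [wInv, riemannInv, sub_eq_add_neg]
  have hz : zInv U = fun p => riemannInv 1 (U p) := by
    ext p
    simp [zInv, riemannInv]
  rw [hw, hz]
  exact ⟨h (-1) (by norm_num), h 1 (by norm_num)⟩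
end
end
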